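/- There is no convex 4-polytope P such that for every facet F of P the interval [∅, F] of the face lattice L(P) is order-isomorphic to the face lattice of the rhombic dodecahedron, and for every vertex v of P the interval [v, P] of L(P) is order-isomorphic to the face lattice of the cuboctahedron. -/

import Mathlib

/-! Generic definitions about flags, flag orbits, and abstract polytopes. -/

variable {α : Type*} [PartialOrder α]

/-- Two flags (maximal chains) are in the same orbit of the automorphism group
(the group of order automorphisms) if some order automorphism maps one onto the other. -/
def SameFlagOrbit (Φ Ψ : Flag α) : Prop :=
  ∃ γ : α ≃o α, γ '' (Φ : Set α) = (Ψ : Set α)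

/-- The automorphism group has exactly two orbits on the flags. -/
def TwoFlagOrbits (α : Type*) [PartialOrder α] : Prop :=
  ∃ Φ Ψ : Flag α, ¬ SameFlagOrbit Φ Ψ ∧
    ∀ Ω : Flag α, SameFlagOrbit Ω Φ ∨ SameFlagOrbit Ω Ψ

/-- `Ψ` is the flag `Φ^i`: it differs from `Φ` in exactly the rank-`i` element
(with respect to the rank function `rk`). -/
def IsIAdjacent (rk : α → ℤ) (i : ℤ) (Φ Ψ : Flag α) : Prop :=
  Φ ≠ Ψ ∧ ∀ x : α, rk x ≠ i → (x ∈ Φ ↔ x ∈ Ψ)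

/-- A two-orbit polytope (with rank function `rk`, adjacency indices `0, …, n-1`)
is in class `2_I` if, for every flag `Φ` and every `i < n`, the `i`-adjacent flag `Φ^i`
lies in the same orbit as `Φ` exactly when `i ∈ I`. -/
def InClass (rk : α → ℤ) (n : ℕ) (I : Set ℕ) : Prop :=
  TwoFlagOrbits α ∧
    ∀ (Φ Ψ : Flag α) (i : ℕ), i < n → IsIAdjacent rk i Φ Ψ →
      (SameFlagOrbit Φ Ψ ↔ i ∈ I)

/-- An abstract polytope of rank `d`: a bounded poset, graded by a rank function `rk`
taking values `-1, 0, …, d`, in which every flag (maximal chain) has exactly one element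
of each rank, satisfying the diamond condition and strong flag-connectivity. -/
structure IsAbstractPolytope (α : Type*) [PartialOrder α] [BoundedOrder α]
    (rk : α → ℤ) (d : ℕ) : Prop where
  rk_bot : rk ⊥ = -1
  rk_top : rk ⊤ = d
  rk_strictMono : StrictMono rk
  rk_cover : ∀ x y : α, x ⋖ y → rk y = rk x + 1
  flag_ranks : ∀ (Φ : Flag α) (i : ℤ), -1 ≤ i → i ≤ d → ∃! x, x ∈ Φ ∧ rk x = i
  diamond : ∀ x y : α, x < y → rk y = rk x + 2 →
    ∃ a b : α, a ≠ b ∧ ∀ z : α, (x < z ∧ z < y) ↔ (z = a ∨ z = b)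
  connected : ∀ Φ Ψ : Flag α, ∃ (n : ℕ) (c : Fin (n + 1) → Flag α),
    c 0 = Φ ∧ c (Fin.last n) = Ψ ∧
    (∀ k : Fin n, ∃ i : ℤ, IsIAdjacent rk i (c k.castSucc) (c k.succ)) ∧
    (∀ k, (Φ : Set α) ∩ (Ψ : Set α) ⊆ (c k : Set α))
/-! Definitions about convex polytopes and their face lattices. -/

/-- Euclidean `d`-space. -/
abbrev EucSp (d : ℕ) : Type := EuclideanSpace ℝ (Fin d)

/-- A convex `d`-polytope: the convex hull of a finite set of points of `ℝ^d`,
with nonempty interior. -/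
def IsConvexPolytope {d : ℕ} (P : Set (EucSp d)) : Prop :=
  (∃ S : Finset (EucSp d), P = convexHull ℝ (S : Set (EucSp d))) ∧ (interior P).Nonempty

/-- The face lattice of `P`: the exposed faces of `P` (intersections of `P` with supporting
hyperplanes, together with `∅` and `P` itself), ordered by inclusion. -/
def Faces {d : ℕ} (P : Set (EucSp d)) : Type := {F : Set (EucSp d) // IsExposed ℝ P F}

noncomputable instance {d : ℕ} (P : Set (EucSp d)) : PartialOrder (Faces P) :=
  Subtype.partialOrder _

open scoped Classical

/-- The rank of a face: `-1` for the empty face, and otherwise its affine dimension. -/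
noncomputable def faceRank {d : ℕ} {P : Set (EucSp d)} (F : Faces P) : ℤ :=
  if F.1 = ∅ then -1
  else (Module.finrank ℝ (affineSpan ℝ F.1).direction : ℤ)
/-! The four two-orbit polyhedra. -/

open scoped RealInnerProductSpace

/-- The point `(a, b, c)` of Euclidean 3-space. -/
noncomputable def pt3 (a b c : ℝ) : EucSp 3 := (WithLp.equiv 2 (Fin 3 → ℝ)).symm ![a, b, c]

/-- The golden ratio. -/
noncomputable def goldenφ : ℝ := (1 + Real.sqrt 5) / 2

/-- The 12 vertices of the cuboctahedron: all permutations of the coordinates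
of `(±1, ±1, 0)`. -/
def cuboctaVerts : Set (EucSp 3) :=
  {x | ∃ ε δ : ℝ, (ε = 1 ∨ ε = -1) ∧ (δ = 1 ∨ δ = -1) ∧
    (x = pt3 ε δ 0 ∨ x = pt3 ε 0 δ ∨ x = pt3 0 ε δ)}

/-- The cuboctahedron. -/
noncomputable def Cuboctahedron : Set (EucSp 3) := convexHull ℝ cuboctaVerts

/-- The 30 vertices of the icosidodecahedron: all cyclic permutations of the coordinates
of `(0, 0, ±φ)` and of `(±1/2, ±φ/2, ±φ²/2)`. -/
def icosidodecaVerts : Set (EucSp 3) :=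
  {x | (∃ ε : ℝ, (ε = 1 ∨ ε = -1) ∧
        (x = pt3 0 0 (ε * goldenφ) ∨ x = pt3 (ε * goldenφ) 0 0 ∨ x = pt3 0 (ε * goldenφ) 0)) ∨
      (∃ ε₁ ε₂ ε₃ : ℝ, (ε₁ = 1 ∨ ε₁ = -1) ∧ (ε₂ = 1 ∨ ε₂ = -1) ∧ (ε₃ = 1 ∨ ε₃ = -1) ∧
        (x = pt3 (ε₁ / 2) (ε₂ * goldenφ / 2) (ε₃ * goldenφ ^ 2 / 2) ∨
         x = pt3 (ε₃ * goldenφ ^ 2 / 2) (ε₁ / 2) (ε₂ * goldenφ / 2) ∨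
         x = pt3 (ε₂ * goldenφ / 2) (ε₃ * goldenφ ^ 2 / 2) (ε₁ / 2)))}

/-- The icosidodecahedron. -/
noncomputable def Icosidodecahedron : Set (EucSp 3) := convexHull ℝ icosidodecaVerts

/-- The 14 vertices of the rhombic dodecahedron: the points `(±1, ±1, ±1)` together with
`(±2, 0, 0)`, `(0, ±2, 0)`, `(0, 0, ±2)`. -/
def rhombicDodecaVerts : Set (EucSp 3) :=
  {x | (∃ ε₁ ε₂ ε₃ : ℝ, (ε₁ = 1 ∨ ε₁ = -1) ∧ (ε₂ = 1 ∨ ε₂ = -1) ∧ (ε₃ = 1 ∨ ε₃ = -1) ∧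
        x = pt3 ε₁ ε₂ ε₃) ∨
      (∃ ε : ℝ, (ε = 2 ∨ ε = -2) ∧ (x = pt3 ε 0 0 ∨ x = pt3 0 ε 0 ∨ x = pt3 0 0 ε))}

/-- The rhombic dodecahedron. -/
noncomputable def RhombicDodecahedron : Set (EucSp 3) := convexHull ℝ rhombicDodecaVerts

/-- The rhombic triacontahedron: the polar dual of the icosidodecahedron. -/
noncomputable def RhombicTriacontahedron : Set (EucSp 3) :=
  {y | ∀ x ∈ Icosidodecahedron, ⟪x, y⟫ ≤ 1}

section RDAngles
variable {V : Type*} [NormedAddCommGroup V] [InnerProductSpace ℝ V]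

open InnerProductGeometry in
theorem rd_angle_add {x y z : V} {a b c : ℝ} (ha : 0 < a) (hb : 0 < b) (hc : 0 < c)
    (hy : y ≠ 0) (h : b • y = a • x + c • z) : angle x z = angle x y + angle y z := by
  apply angle_eq_angle_add_add_angle_add_of_mem_span hy
  rw [Submodule.mem_span_pair]
  refine ⟨(a / b).toNNReal, (c / b).toNNReal, ?_⟩
  simp only [NNReal.smul_def]
  rw [Real.coe_toNNReal _ (by positivity), Real.coe_toNNReal _ (by positivity)]
  have : y = b⁻¹ • (b • y) := by rw [smul_smul, inv_mul_cancel₀ hb.ne', one_smul]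
  rw [this, h, smul_add, smul_smul, smul_smul]
  congr 2 <;> ring

/-- Perimeter of a convex spherical quadrilateral is less than `2π`. -/
theorem rd_pyramid {u0 u1 u2 u3 : V} {a0 a1 a2 a3 : ℝ} (h0 : 0 < a0) (h1 : 0 < a1) (h2 : 0 < a2)
    (h3 : 0 < a3) (h : a0 • u0 + a2 • u2 = a1 • u1 + a3 • u3)
    (l0 l2 l3 : V →ₗ[ℝ] ℝ)
    (l00 : l0 u0 = 0) (l01 : l0 u1 = 0) (l02 : l0 u2 < 0)
    (l22 : l2 u2 = 0) (l23 : l2 u3 = 0) (l21 : l2 u1 < 0)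
    (l30 : l3 u0 = 0) (l31 : l3 u1 < 0) (l32 : l3 u2 < 0) :
    InnerProductGeometry.angle u0 u1 + InnerProductGeometry.angle u1 u2 +
      InnerProductGeometry.angle u2 u3 + InnerProductGeometry.angle u3 u0 < 2 * Real.pi := by
  obtain ⟨q, hq⟩ : ∃ q, q = a1 • u1 - a0 • u0 := ⟨_, rfl⟩
  have hq' : q = a2 • u2 - a3 • u3 := by
    rw [hq, sub_eq_sub_iff_add_eq_add, ← h]; abel
  have u1n : u1 ≠ 0 := by rintro rfl; simp at l31
  have u2n : u2 ≠ 0 := by rintro rfl; simp at l32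
  have hq0 : q ≠ 0 := by
    intro hh
    have := congrArg l3 hq
    simp [hh, l30] at this
    rcases this with h | h <;> linarith
  have e1 := rd_angle_add (x := u0) (y := u1) (z := q) h0 h1 one_pos u1n (by rw [hq]; module)
  have e2 := rd_angle_add (x := u3) (y := u2) (z := q) h3 h2 one_pos u2n (by rw [hq']; module)
  have e3 : InnerProductGeometry.angle u1 u2 <
      InnerProductGeometry.angle u1 q + InnerProductGeometry.angle q u2 := by
    refine lt_of_le_of_ne (InnerProductGeometry.angle_le_angle_add_angle _ _ _) ?_
    intro hh
    rw [InnerProductGeometry.angle_eq_angle_add_angle_iff hq0] at hh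
    rcases hh with hh | hh
    · rw [InnerProductGeometry.angle_eq_pi_iff] at hh
      obtain ⟨-, r, hr, rfl⟩ := hh
      simp at l32
      nlinarith
    · rw [Submodule.mem_span_pair] at hh
      obtain ⟨s, t, hst⟩ := hh
      simp only [NNReal.smul_def] at hst
      have k0 := congrArg l0 hst
      have k2 := congrArg l2 hst
      rw [hq'] at k2
      rw [hq] at k0
      simp [l00, l01, l02.ne] at k0
      simp [l22, l23, l21.ne] at k2
      simp [k0, k2] at hst
      exact hq0 hst.symm
  have e4 := InnerProductGeometry.angle_le_angle_add_angle q (-u0) u3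
  rw [InnerProductGeometry.angle_neg_right, InnerProductGeometry.angle_neg_left] at e4
  simp only [InnerProductGeometry.angle_comm q, InnerProductGeometry.angle_comm u3 u2,
    InnerProductGeometry.angle_comm u3 u0] at *
  linarith

open EuclideanGeometry in
/-- The angle sum of a planar convex quadrilateral is `2π`. -/
theorem rd_quad {x0 x1 x2 x3 : V} {a0 a1 a2 a3 : ℝ} (h0 : 0 < a0) (h1 : 0 < a1) (h2 : 0 < a2)
    (h3 : 0 < a3) (h : a0 • x0 + a2 • x2 = a1 • x1 + a3 • x3) (hs : a0 + a2 = a1 + a3)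
    (n02 : x0 ≠ x2) (n13 : x1 ≠ x3) :
    ∠ x3 x0 x1 + ∠ x0 x1 x2 + ∠ x1 x2 x3 + ∠ x2 x3 x0 = 2 * Real.pi := by
  have key : ∀ {x y : V} {a b : ℝ}, 0 < a → 0 < b → x ≠ y →
      Sbtw ℝ x ((a + b)⁻¹ • (a • x + b • y)) y := by
    intro x y a b ha hb hxy
    rw [sbtw_iff_mem_image_Ioo_and_ne]
    refine ⟨⟨b / (a + b), ⟨by positivity, by rw [div_lt_one (by positivity)]; linarith⟩, ?_⟩, hxy⟩
    have : a / (a + b) = 1 - b / (a + b) := by field_simp; ring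
    rw [AffineMap.lineMap_apply_module, ← this]
    rw [smul_add, smul_smul, smul_smul]
    congr 2 <;> ring
  have s02 := key h0 h2 n02
  have s13 := key h1 h3 n13
  rw [← h, ← hs] at s13
  set p := (a0 + a2)⁻¹ • (a0 • x0 + a2 • x2)
  have t01 := angle_add_angle_add_angle_eq_pi x1 (p₁ := p) (p₂ := x0) s02.left_ne
  have t12 := angle_add_angle_add_angle_eq_pi x2 (p₁ := p) (p₂ := x1) s13.left_ne
  have t23 := angle_add_angle_add_angle_eq_pi x3 (p₁ := p) (p₂ := x2) s02.ne_right.symm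
  have t30 := angle_add_angle_add_angle_eq_pi x0 (p₁ := p) (p₂ := x3) s13.ne_right.symm
  have b0 := angle_add_angle_eq_of_sbtw (p := x0) s13
  have b2 := angle_add_angle_eq_of_sbtw (p := x2) s13
  have b1 := angle_add_angle_eq_of_sbtw (p := x1) s02
  have b3 := angle_add_angle_eq_of_sbtw (p := x3) s02
  have c0 := angle_add_angle_eq_pi_of_angle_eq_pi x0 s13.angle₁₂₃_eq_pi
  have c2 := angle_add_angle_eq_pi_of_angle_eq_pi x2 s13.angle₁₂₃_eq_pi
  have r1 := angle_comm x1 p x0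
  have r2 := angle_comm x2 p x1
  have r3 := angle_comm x3 p x2
  have r4 := angle_comm x0 p x3
  have q1 := angle_comm x3 x0 x1
  have q2 := angle_comm x3 x0 p
  have q3 := angle_comm x1 x0 p
  have q4 := angle_comm x0 x1 p
  have q5 := angle_comm x1 x2 p
  have q6 := angle_comm x3 x2 p
  have q7 := angle_comm x0 x3 p
  have q8 := angle_comm x2 x3 p
  have q9 := angle_comm x2 x3 x0
  linarith

/-- Alternating signs. -/
theorem rd_signs {c0 c1 c2 c3 : ℝ} (hc : ¬ (c0 = 0 ∧ c1 = 0 ∧ c2 = 0 ∧ c3 = 0))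
    {m02 m03 m20 m21 m31 m32 : ℝ}
    (n02 : m02 < 0) (n03 : m03 < 0) (n20 : m20 < 0) (n21 : m21 < 0) (n31 : m31 < 0) (n32 : m32 < 0)
    (e0 : c2 * m02 + c3 * m03 = 0)
    (e2 : c0 * m20 + c1 * m21 = 0) (e3 : c1 * m31 + c2 * m32 = 0) :
    (0 < c0 ∧ 0 < -c1 ∧ 0 < c2 ∧ 0 < -c3) ∨ (0 < -c0 ∧ 0 < c1 ∧ 0 < -c2 ∧ 0 < c3) := by
  have pos : ∀ {a b m n : ℝ}, m < 0 → n < 0 → a * m + b * n = 0 → 0 < a → b < 0 := by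
    intro a b m n hm hn h ha; by_contra hb; nlinarith
  have neg : ∀ {a b m n : ℝ}, m < 0 → n < 0 → a * m + b * n = 0 → a < 0 → 0 < b := by
    intro a b m n hm hn h ha; by_contra hb; nlinarith
  have zer : ∀ {a b m n : ℝ}, m < 0 → n < 0 → a * m + b * n = 0 → a = 0 → b = 0 := by
    rintro a b m n hm hn h rfl; simpa [hn.ne] using h
  rcases lt_trichotomy c0 0 with h | h | h
  · have k1 := neg n20 n21 e2 h
    have k2 := pos n31 n32 e3 k1
    have k3 := neg n02 n03 e0 k2
    right; refine ⟨?_, ?_, ?_, ?_⟩ <;> linarith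
  · have k1 := zer n20 n21 e2 h
    have k2 := zer n31 n32 e3 k1
    have k3 := zer n02 n03 e0 k2
    exact absurd ⟨h, k1, k2, k3⟩ hc
  · have k1 := pos n20 n21 e2 h
    have k2 := neg n31 n32 e3 k1
    have k3 := pos n02 n03 e0 k2
    left; refine ⟨?_, ?_, ?_, ?_⟩ <;> linarith

end RDAngles

section RDFaces
variable {d : ℕ}

theorem rd_face_hull {V : Set (EucSp d)} (hV : V.Finite) {F : Set (EucSp d)}
    (hF : IsExposed ℝ (convexHull ℝ V) F) : F = convexHull ℝ (F ∩ V) := by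
  have hconv : Convex ℝ F := hF.convex (convex_convexHull ℝ V)
  have hcomp : IsCompact F := hF.isCompact (hV.isCompact_convexHull (𝕜 := ℝ))
  apply Set.Subset.antisymm
  · have h1 := closure_convexHull_extremePoints hcomp hconv
    have h2 : F.extremePoints ℝ ⊆ F ∩ V := by
      intro x hx
      refine ⟨hx.1, ?_⟩
      exact extremePoints_convexHull_subset (hF.isExtreme.extremePoints_subset_extremePoints hx)
    rw [← h1]
    refine closure_minimal (convexHull_mono ?_) ?_
    · rw [h1]; exact h2
    · rw [h1]
      exact ((hV.subset Set.inter_subset_right).isCompact_convexHull (𝕜 := ℝ)).isClosed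
  · exact convexHull_min Set.inter_subset_left hconv

theorem rd_face_le {V : Set (EucSp d)} (hV : V.Finite) {F G : Faces (convexHull ℝ V)}
    (h : F.1 ∩ V ⊆ G.1) : F ≤ G := by
  change F.1 ⊆ G.1
  rw [rd_face_hull hV F.2]
  exact convexHull_min h (G.2.convex (convex_convexHull ℝ V))

theorem rd_finite_faces (S : Finset (EucSp d)) :
    Finite (Faces (convexHull ℝ (S : Set (EucSp d)))) := by
  let f : Faces (convexHull ℝ (S : Set (EucSp d))) → Set.powerset (S : Set (EucSp d)) :=
    fun F => ⟨F.1 ∩ S, Set.inter_subset_right⟩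
  have : Finite (Set.powerset (S : Set (EucSp d))) := S.finite_toSet.powerset
  refine Finite.of_injective f ?_
  intro F G h
  have h' : F.1 ∩ (S : Set (EucSp d)) = G.1 ∩ S := congrArg Subtype.val h
  refine le_antisymm (rd_face_le S.finite_toSet ?_) (rd_face_le S.finite_toSet ?_)
  · rw [h']; exact Set.inter_subset_left
  · rw [← h']; exact Set.inter_subset_left

theorem rd_exists_functional {P : Set (EucSp d)} (F : Faces P) (hne : F.1.Nonempty) :
    ∃ (l : StrongDual ℝ (EucSp d)) (m : ℝ), F.1 ⊆ P ∧ (∀ x ∈ P, l x ≤ m) ∧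
      (∀ x ∈ P, x ∈ F.1 ↔ l x = m) := by
  obtain ⟨l, hl⟩ := F.2 hne
  obtain ⟨z, hz⟩ := hne
  have hz' := hz
  rw [hl] at hz'
  refine ⟨l, l z, F.2.subset, hz'.2, ?_⟩
  intro x hx
  rw [hl]
  constructor
  · rintro ⟨_, h⟩
    exact le_antisymm (hz'.2 x hx) (h z hz'.1)
  · intro h
    exact ⟨hx, fun y hy => by rw [h]; exact hz'.2 y hy⟩

theorem rd_rank_nonneg {P : Set (EucSp d)} (F : Faces P) (h : F.1.Nonempty) : 0 ≤ faceRank F := by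
  rw [faceRank, if_neg h.ne_empty]; positivity

theorem rd_rank_ge {P : Set (EucSp d)} (F : Faces P) : -1 ≤ faceRank F := by
  rw [faceRank]; split_ifs <;> omega

theorem rd_rank_le {P : Set (EucSp d)} (F : Faces P) : faceRank F ≤ d := by
  rw [faceRank]; split_ifs
  · omega
  · have := Submodule.finrank_le (affineSpan ℝ F.1).direction
    simp at this
    exact_mod_cast this

theorem rd_rank_strictMono {P : Set (EucSp d)} : StrictMono (faceRank : Faces P → ℤ) := by
  intro F G hFG
  have hsub : F.1 ⊆ G.1 := hFG.le
  have hG : G.1.Nonempty := by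
    rw [Set.nonempty_iff_ne_empty]
    intro h
    apply hFG.not_ge
    change G.1 ⊆ F.1
    rw [h]; exact Set.empty_subset _
  by_cases hF : F.1 = ∅
  · have := rd_rank_nonneg G hG
    have h2 : faceRank F = -1 := by rw [faceRank, if_pos hF]
    omega
  have hFn : F.1.Nonempty := Set.nonempty_iff_ne_empty.2 hF
  rw [faceRank, faceRank, if_neg hF, if_neg hG.ne_empty]
  norm_cast
  obtain ⟨l, m, hFP, hm, hmem⟩ := rd_exists_functional F hFn
  have hspan : affineSpan ℝ F.1 ≤ affineSpan ℝ G.1 := affineSpan_mono ℝ hsub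
  refine Submodule.finrank_lt_finrank_of_lt (lt_of_le_of_ne (AffineSubspace.direction_le hspan) ?_)
  intro heq
  have h2 : affineSpan ℝ F.1 = affineSpan ℝ G.1 :=
    AffineSubspace.eq_of_direction_eq_of_nonempty_of_le heq
      ((affineSpan_nonempty ℝ).2 hFn) hspan
  apply hFG.not_ge
  intro x hx
  have hxF : x ∈ affineSpan ℝ F.1 := by rw [h2]; exact subset_affineSpan ℝ _ hx
  rw [hmem x (G.2.subset hx)]
  have : ∀ y ∈ affineSpan ℝ F.1, l y = m := by
    intro y hy
    refine affineSpan_induction (p := fun y => l y = m) hy ?_ ?_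
    · intro z hz; exact (hmem z (hFP hz)).1 hz
    · intro c u v w hu hv hw
      simp [hu, hv, hw]
  exact this x hxF

theorem rd_rank_zero {P : Set (EucSp d)} (F : Faces P) (h : faceRank F = 0) :
    ∃ x, F.1 = {x} := by
  rw [faceRank] at h
  split_ifs at h with h0
  have h1 : Module.finrank ℝ (affineSpan ℝ F.1).direction = 0 := by exact_mod_cast h
  rw [Submodule.finrank_eq_zero, direction_affineSpan, vectorSpan_eq_bot_iff_subsingleton] at h1
  obtain ⟨x, hx⟩ := Set.nonempty_iff_ne_empty.2 h0
  exact ⟨x, h1.eq_singleton_of_mem hx⟩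

theorem rd_exists_vertex (S : Finset (EucSp d)) (hne : S.Nonempty) :
    ∃ v : Faces (convexHull ℝ (S : Set (EucSp d))), faceRank v = 0 := by
  obtain ⟨x, hxS, hx⟩ := S.exists_max_image (fun y => ‖y‖) hne
  have hP : ∀ y ∈ convexHull ℝ (S : Set (EucSp d)), ‖y‖ ≤ ‖x‖ := by
    intro y hy
    have : convexHull ℝ (S : Set (EucSp d)) ⊆ Metric.closedBall 0 ‖x‖ :=
      convexHull_min (fun z hz => by simpa using hx z hz) (convex_closedBall _ _)
    simpa using this hy
  have hxP : x ∈ convexHull ℝ (S : Set (EucSp d)) := subset_convexHull ℝ _ hxS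
  refine ⟨⟨{x}, fun _ => ⟨innerSL ℝ x, ?_⟩⟩, ?_⟩
  · ext y
    simp only [Set.mem_singleton_iff, Set.mem_ofPred_eq, innerSL_apply_apply]
    constructor
    · rintro rfl
      refine ⟨hxP, fun z hz => ?_⟩
      calc ⟪y, z⟫ ≤ ‖y‖ * ‖z‖ := real_inner_le_norm _ _
        _ ≤ ‖y‖ * ‖y‖ := by gcongr; exact hP z hz
        _ = ⟪y, y⟫ := (real_inner_self_eq_norm_mul_norm y).symm
    · rintro ⟨hy, h⟩
      have h1 := h x hxP
      have h2 := hP y hy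
      have h3 := norm_sub_sq_real x y
      rw [real_inner_self_eq_norm_sq] at h1
      have h4 : ‖x - y‖ ^ 2 ≤ 0 := by
        nlinarith [norm_nonneg x, norm_nonneg y]
      have h5 : ‖x - y‖ = 0 := by nlinarith [norm_nonneg (x - y)]
      rw [norm_eq_zero, sub_eq_zero] at h5
      exact h5.symm
  · unfold faceRank
    rw [if_neg (Set.singleton_ne_empty x)]
    rw [direction_affineSpan, vectorSpan_singleton, finrank_bot]
    rfl

/-- The face lattice of a polytope with explicitly known argmax sets. -/
theorem rd_faces_iso {ι D : Type*} [Finite ι] [Nonempty ι] [PartialOrder D]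
    (V : ι → EucSp d) (K : D → Set ι)
    (hK : ∀ x y, x ≤ y ↔ K x ⊆ K y)
    (hl : ∀ x, K x = ∅ ∨ ∃ l : StrongDual ℝ (EucSp d), K x = {i | ∀ j, l (V j) ≤ l (V i)})
    (hs : ∀ l : StrongDual ℝ (EucSp d), ∃ x, K x = {i | ∀ j, l (V j) ≤ l (V i)})
    (he : ∃ x, K x = ∅) : Nonempty (D ≃o Faces (convexHull ℝ (Set.range V))) := by
  have hfin : (Set.range V).Finite := Set.finite_range V
  have hmax : ∀ (l : StrongDual ℝ (EucSp d)) (x : EucSp d),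
      (∀ y ∈ convexHull ℝ (Set.range V), l y ≤ l x) ↔ ∀ j, l (V j) ≤ l x := by
    intro l x
    constructor
    · intro h j; exact h _ (subset_convexHull ℝ _ ⟨j, rfl⟩)
    · intro h y hy
      have : convexHull ℝ (Set.range V) ⊆ {y | l y ≤ l x} := by
        refine convexHull_min ?_ (convex_halfSpace_le l.isLinear _)
        rintro _ ⟨j, rfl⟩; exact h j
      exact this hy
  have hface : ∀ x : D, ∃ F : Faces (convexHull ℝ (Set.range V)), ∀ i, V i ∈ F.1 ↔ i ∈ K x := by
    intro x
    rcases hl x with h | ⟨l, h⟩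
    · exact ⟨⟨∅, isExposed_empty⟩, by simp [h]⟩
    · refine ⟨⟨l.toExposed (convexHull ℝ (Set.range V)),
        ContinuousLinearMap.toExposed.isExposed⟩, fun i => ?_⟩
      rw [h]
      constructor
      · rintro ⟨_, h2⟩; exact (hmax l _).1 h2
      · intro h2; exact ⟨subset_convexHull ℝ _ ⟨i, rfl⟩, (hmax l _).2 h2⟩
  choose f hf using hface
  have hle : ∀ F G : Faces (convexHull ℝ (Set.range V)),
      F ≤ G ↔ ∀ i, V i ∈ F.1 → V i ∈ G.1 := by
    intro F G
    constructor
    · intro h i hi; exact h hi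
    · intro h
      apply rd_face_le hfin
      rintro _ ⟨hx, i, rfl⟩
      exact h i hx
  have hemb : ∀ x y, f x ≤ f y ↔ x ≤ y := by
    intro x y
    rw [hle, hK]
    simp only [hf]
    rfl
  have hsurj : Function.Surjective f := by
    intro F
    obtain ⟨x, hx⟩ : ∃ x, ∀ i, i ∈ K x ↔ V i ∈ F.1 := by
      by_cases hF : F.1.Nonempty
      · obtain ⟨l, h⟩ := F.2 hF
        obtain ⟨x, hx⟩ := hs l
        refine ⟨x, fun i => ?_⟩
        rw [hx, h]
        constructor
        · intro h2; exact ⟨subset_convexHull ℝ _ ⟨i, rfl⟩, (hmax l _).2 h2⟩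
        · rintro ⟨_, h2⟩; exact (hmax l _).1 h2
      · rw [Set.not_nonempty_iff_eq_empty] at hF
        obtain ⟨x, hx⟩ := he
        exact ⟨x, by simp [hx, hF]⟩
    refine ⟨x, le_antisymm ((hle _ _).2 ?_) ((hle _ _).2 ?_)⟩ <;>
    · intro i; rw [hf, hx]; exact id
  refine ⟨RelIso.ofSurjective (OrderEmbedding.ofMapLEIff f hemb) hsurj⟩

end RDFaces

section RDModel

/-- Codes of pairs `(A, C)` of subsets of `Fin 4`: bit `i` says `i ∈ A`, bit `4 + i` says `i ∈ C`.
We keep the pairs with `A`, `C` disjoint and both or none empty, together with the full pair. -/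
def rdCodes : List ℕ :=
  [
   0, 18, 20, 22, 24, 26, 28, 30, 33, 36, 37, 40, 41, 44, 45, 52, 56, 60, 65, 66, 67, 72,
   73, 74, 75, 82, 88, 90, 97, 104, 105, 120, 129, 130, 131, 132, 133, 134, 135, 146, 148,
   150, 161, 164, 165, 180, 193, 194, 195, 210, 225, 255]

/-- The common model of the face lattice of the cuboctahedron and, reversed, of the
rhombic dodecahedron. -/
def RDModel : Type := {n : ℕ // n ∈ rdCodes}

instance : PartialOrder RDModel where
  le x y := x.1 &&& y.1 = x.1
  le_refl x := Nat.and_self x.1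
  le_trans x y z h1 h2 := by
    have h1' : x.1 &&& y.1 = x.1 := h1
    have h2' : y.1 &&& z.1 = y.1 := h2
    rw [← h1', Nat.and_assoc, h2']
  le_antisymm x y h1 h2 := by
    have h1' : x.1 &&& y.1 = x.1 := h1
    have h2' : y.1 &&& x.1 = y.1 := h2
    apply Subtype.ext
    rw [← h1', Nat.and_comm, h2']

theorem rd_model_le_iff (x y : RDModel) : x ≤ y ↔ x.1 &&& y.1 = x.1 := Iff.rfl

theorem rd_model_bits : ∀ x ∈ rdCodes, ∀ y ∈ rdCodes, (x &&& y = x) ↔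
    ∀ i : Fin 4, (x.testBit i → y.testBit i) ∧ (x.testBit (4 + i) → y.testBit (4 + i)) := by
  decide +kernel

theorem rd_model_nonempty : ∀ x ∈ rdCodes, x = 0 ∨
    (∃ i : Fin 4, x.testBit i) ∧ (∃ i : Fin 4, x.testBit (4 + i)) := by
  decide +kernel

theorem rd_model_disjoint : ∀ x ∈ rdCodes, x = 255 ∨
    ∀ i : Fin 4, ¬ (x.testBit i ∧ x.testBit (4 + i)) := by
  decide +kernel

theorem rd_model_exists : ∀ A C : Fin 4 → Bool,
    (((∃ i, A i) ↔ (∃ i, C i)) ∧ (∀ i, ¬ (A i ∧ C i))) ∨ (∀ i, A i ∧ C i) →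
    ∃ x ∈ rdCodes, ∀ i : Fin 4, x.testBit i = A i ∧ x.testBit (4 + i) = C i := by
  decide +kernel

/-- Integer weight attached to a code. -/
def rdW (x : ℕ) (i : Fin 4) : ℤ :=
  (if x.testBit i then 1 else 0) - (if x.testBit (4 + i) then 1 else 0)

theorem rd_model_weight : ∀ x ∈ rdCodes, x ≠ 0 → ∀ i : Fin 4,
    (x.testBit i ↔ ∀ j, rdW x j ≤ rdW x i) ∧ (x.testBit (4 + i) ↔ ∀ j, rdW x i ≤ rdW x j) := by
  decide +kernel

/-- Balanced integer weight attached to a code. -/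
def rdW' (x : ℕ) (i : Fin 4) : ℤ :=
  (if x.testBit i then (if x.testBit 4 then 1 else 0) + (if x.testBit 5 then 1 else 0) +
    (if x.testBit 6 then 1 else 0) + (if x.testBit 7 then 1 else 0) else 0) -
  (if x.testBit (4 + i) then (if x.testBit 0 then 1 else 0) + (if x.testBit 1 then 1 else 0) +
    (if x.testBit 2 then 1 else 0) + (if x.testBit 3 then 1 else 0) else 0)

theorem rd_model_weight' : ∀ x ∈ rdCodes, x ≠ 255 →
    rdW' x 0 + rdW' x 1 + rdW' x 2 + rdW' x 3 = 0 ∧ ∀ i : Fin 4,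
    (x.testBit i ↔ 0 < rdW' x i) ∧ (x.testBit (4 + i) ↔ rdW' x i < 0) := by
  decide +kernel

end RDModel

section RDIsos

/-- Four vectors pointing to the vertices of a regular tetrahedron. -/
noncomputable def rdG : Fin 4 → EucSp 3 :=
  ![pt3 1 1 1, pt3 1 (-1) (-1), pt3 (-1) 1 (-1), pt3 (-1) (-1) 1]

theorem rd_pt3_0 (a b c : ℝ) : (pt3 a b c) 0 = a := rfl
theorem rd_pt3_1 (a b c : ℝ) : (pt3 a b c) 1 = b := rfl
theorem rd_pt3_2 (a b c : ℝ) : (pt3 a b c) 2 = c := rfl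
theorem rdG_0 : rdG 0 = pt3 1 1 1 := rfl
theorem rdG_1 : rdG 1 = pt3 1 (-1) (-1) := rfl
theorem rdG_2 : rdG 2 = pt3 (-1) 1 (-1) := rfl
theorem rdG_3 : rdG 3 = pt3 (-1) (-1) 1 := rfl

theorem rd_p3 (a b c : ℝ) (y : EucSp 3) (h0 : y 0 = a) (h1 : y 1 = b) (h2 : y 2 = c) :
    y = pt3 a b c := by
  ext i
  fin_cases i
  · exact h0
  · exact h1
  · exact h2

theorem rdG_sum : rdG 0 + rdG 1 + rdG 2 + rdG 3 = 0 := by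
  have h : (0 : EucSp 3) = pt3 0 0 0 := (rd_p3 _ _ _ _ rfl rfl rfl)
  rw [h, rdG_0, rdG_1, rdG_2, rdG_3]
  apply rd_p3 <;> simp only [PiLp.add_apply, rd_pt3_0, rd_pt3_1, rd_pt3_2] <;> norm_num

/-- A functional with prescribed values (up to a common shift) on the tetrahedron. -/
theorem rdG_functional (s : Fin 4 → ℝ) : ∃ l : StrongDual ℝ (EucSp 3),
    ∀ i, l (rdG i) = 4 * s i - (s 0 + s 1 + s 2 + s 3) := by
  refine ⟨innerSL ℝ (s 0 • rdG 0 + s 1 • rdG 1 + s 2 • rdG 2 + s 3 • rdG 3), fun i => ?_⟩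
  have key : ∀ j, (innerSL ℝ (s 0 • rdG 0 + s 1 • rdG 1 + s 2 • rdG 2 + s 3 • rdG 3)) (rdG j) =
      s 0 * inner ℝ (rdG 0) (rdG j) + s 1 * inner ℝ (rdG 1) (rdG j) +
      s 2 * inner ℝ (rdG 2) (rdG j) + s 3 * inner ℝ (rdG 3) (rdG j) := by
    intro j
    rw [innerSL_apply_apply]
    simp only [inner_add_left, inner_smul_left]
    rfl
  have ip : ∀ a b c a' b' c' : ℝ, inner ℝ (pt3 a b c) (pt3 a' b' c') = a * a' + b * b' + c * c' := by
    intro a b c a' b' c'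
    rw [PiLp.inner_apply, Fin.sum_univ_three]
    simp only [rd_pt3_0, rd_pt3_1, rd_pt3_2]
    change a' * a + b' * b + c' * c = _
    ring
  rw [key]
  match i with
  | 0 => simp only [rdG_0, rdG_1, rdG_2, rdG_3, ip]; ring
  | 1 => simp only [rdG_0, rdG_1, rdG_2, rdG_3, ip]; ring
  | 2 => simp only [rdG_0, rdG_1, rdG_2, rdG_3, ip]; ring
  | 3 => simp only [rdG_0, rdG_1, rdG_2, rdG_3, ip]; ring

/-- Vertices of the cuboctahedron and the origin. -/
noncomputable def rdCV (p : Fin 4 × Fin 4) : EucSp 3 := (1 / 2 : ℝ) • (rdG p.1 - rdG p.2)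

/-- Vertices of the rhombic dodecahedron and the origin. -/
noncomputable def rdRV (B : Fin 4 → Bool) : EucSp 3 := ∑ i, if B i then rdG i else 0

theorem rdCV_apply (i j : Fin 4) (k : Fin 3) : rdCV (i, j) k = 1 / 2 * (rdG i k - rdG j k) := rfl

theorem rd_zero_mem {V : Set (EucSp 3)} {x : EucSp 3} (h1 : x ∈ V) (h2 : -x ∈ V) :
    (0 : EucSp 3) ∈ convexHull ℝ V := by
  have := (convex_convexHull ℝ V) (subset_convexHull ℝ V h1) (subset_convexHull ℝ V h2)
    (a := 1 / 2) (b := 1 / 2) (by norm_num) (by norm_num) (by norm_num)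
  simpa using this

theorem rd_cubocta_hull : Cuboctahedron = convexHull ℝ (Set.range rdCV) := by
  have key : ∀ a b c : ℝ, -pt3 a b c = pt3 (-a) (-b) (-c) := by
    intro a b c; ext i; fin_cases i <;> simp [pt3]
  have hz : (0 : EucSp 3) ∈ Cuboctahedron := by
    apply rd_zero_mem (x := pt3 1 1 0)
    · exact ⟨1, 1, by simp, by simp, by simp⟩
    · exact ⟨-1, -1, by simp, by simp, by simp [key]⟩
  apply Set.Subset.antisymm
  · apply convexHull_mono
    rintro x ⟨ε, δ, hε, hδ, hx⟩
    have e : ∀ (i j : Fin 4) (y : EucSp 3), y = rdCV (i, j) → y ∈ Set.range rdCV :=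
      fun i j y h => ⟨(i, j), h.symm⟩
    rcases hε with rfl | rfl <;> rcases hδ with rfl | rfl <;> rcases hx with rfl | rfl | rfl
    · exact e 0 3 _ (rd_p3 _ _ _ _ (by norm_num [rdCV_apply, rdG_0, rdG_1, rdG_2, rdG_3, rd_pt3_0, rd_pt3_1, rd_pt3_2]) (by norm_num [rdCV_apply, rdG_0, rdG_1, rdG_2, rdG_3, rd_pt3_0, rd_pt3_1, rd_pt3_2]) (by norm_num [rdCV_apply, rdG_0, rdG_1, rdG_2, rdG_3, rd_pt3_0, rd_pt3_1, rd_pt3_2])).symm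
    · exact e 0 2 _ (rd_p3 _ _ _ _ (by norm_num [rdCV_apply, rdG_0, rdG_1, rdG_2, rdG_3, rd_pt3_0, rd_pt3_1, rd_pt3_2]) (by norm_num [rdCV_apply, rdG_0, rdG_1, rdG_2, rdG_3, rd_pt3_0, rd_pt3_1, rd_pt3_2]) (by norm_num [rdCV_apply, rdG_0, rdG_1, rdG_2, rdG_3, rd_pt3_0, rd_pt3_1, rd_pt3_2])).symm
    · exact e 0 1 _ (rd_p3 _ _ _ _ (by norm_num [rdCV_apply, rdG_0, rdG_1, rdG_2, rdG_3, rd_pt3_0, rd_pt3_1, rd_pt3_2]) (by norm_num [rdCV_apply, rdG_0, rdG_1, rdG_2, rdG_3, rd_pt3_0, rd_pt3_1, rd_pt3_2]) (by norm_num [rdCV_apply, rdG_0, rdG_1, rdG_2, rdG_3, rd_pt3_0, rd_pt3_1, rd_pt3_2])).symm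
    · exact e 1 2 _ (rd_p3 _ _ _ _ (by norm_num [rdCV_apply, rdG_0, rdG_1, rdG_2, rdG_3, rd_pt3_0, rd_pt3_1, rd_pt3_2]) (by norm_num [rdCV_apply, rdG_0, rdG_1, rdG_2, rdG_3, rd_pt3_0, rd_pt3_1, rd_pt3_2]) (by norm_num [rdCV_apply, rdG_0, rdG_1, rdG_2, rdG_3, rd_pt3_0, rd_pt3_1, rd_pt3_2])).symm
    · exact e 1 3 _ (rd_p3 _ _ _ _ (by norm_num [rdCV_apply, rdG_0, rdG_1, rdG_2, rdG_3, rd_pt3_0, rd_pt3_1, rd_pt3_2]) (by norm_num [rdCV_apply, rdG_0, rdG_1, rdG_2, rdG_3, rd_pt3_0, rd_pt3_1, rd_pt3_2]) (by norm_num [rdCV_apply, rdG_0, rdG_1, rdG_2, rdG_3, rd_pt3_0, rd_pt3_1, rd_pt3_2])).symm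
    · exact e 2 3 _ (rd_p3 _ _ _ _ (by norm_num [rdCV_apply, rdG_0, rdG_1, rdG_2, rdG_3, rd_pt3_0, rd_pt3_1, rd_pt3_2]) (by norm_num [rdCV_apply, rdG_0, rdG_1, rdG_2, rdG_3, rd_pt3_0, rd_pt3_1, rd_pt3_2]) (by norm_num [rdCV_apply, rdG_0, rdG_1, rdG_2, rdG_3, rd_pt3_0, rd_pt3_1, rd_pt3_2])).symm
    · exact e 2 1 _ (rd_p3 _ _ _ _ (by norm_num [rdCV_apply, rdG_0, rdG_1, rdG_2, rdG_3, rd_pt3_0, rd_pt3_1, rd_pt3_2]) (by norm_num [rdCV_apply, rdG_0, rdG_1, rdG_2, rdG_3, rd_pt3_0, rd_pt3_1, rd_pt3_2]) (by norm_num [rdCV_apply, rdG_0, rdG_1, rdG_2, rdG_3, rd_pt3_0, rd_pt3_1, rd_pt3_2])).symm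
    · exact e 3 1 _ (rd_p3 _ _ _ _ (by norm_num [rdCV_apply, rdG_0, rdG_1, rdG_2, rdG_3, rd_pt3_0, rd_pt3_1, rd_pt3_2]) (by norm_num [rdCV_apply, rdG_0, rdG_1, rdG_2, rdG_3, rd_pt3_0, rd_pt3_1, rd_pt3_2]) (by norm_num [rdCV_apply, rdG_0, rdG_1, rdG_2, rdG_3, rd_pt3_0, rd_pt3_1, rd_pt3_2])).symm
    · exact e 3 2 _ (rd_p3 _ _ _ _ (by norm_num [rdCV_apply, rdG_0, rdG_1, rdG_2, rdG_3, rd_pt3_0, rd_pt3_1, rd_pt3_2]) (by norm_num [rdCV_apply, rdG_0, rdG_1, rdG_2, rdG_3, rd_pt3_0, rd_pt3_1, rd_pt3_2]) (by norm_num [rdCV_apply, rdG_0, rdG_1, rdG_2, rdG_3, rd_pt3_0, rd_pt3_1, rd_pt3_2])).symm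
    · exact e 3 0 _ (rd_p3 _ _ _ _ (by norm_num [rdCV_apply, rdG_0, rdG_1, rdG_2, rdG_3, rd_pt3_0, rd_pt3_1, rd_pt3_2]) (by norm_num [rdCV_apply, rdG_0, rdG_1, rdG_2, rdG_3, rd_pt3_0, rd_pt3_1, rd_pt3_2]) (by norm_num [rdCV_apply, rdG_0, rdG_1, rdG_2, rdG_3, rd_pt3_0, rd_pt3_1, rd_pt3_2])).symm
    · exact e 2 0 _ (rd_p3 _ _ _ _ (by norm_num [rdCV_apply, rdG_0, rdG_1, rdG_2, rdG_3, rd_pt3_0, rd_pt3_1, rd_pt3_2]) (by norm_num [rdCV_apply, rdG_0, rdG_1, rdG_2, rdG_3, rd_pt3_0, rd_pt3_1, rd_pt3_2]) (by norm_num [rdCV_apply, rdG_0, rdG_1, rdG_2, rdG_3, rd_pt3_0, rd_pt3_1, rd_pt3_2])).symm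
    · exact e 1 0 _ (rd_p3 _ _ _ _ (by norm_num [rdCV_apply, rdG_0, rdG_1, rdG_2, rdG_3, rd_pt3_0, rd_pt3_1, rd_pt3_2]) (by norm_num [rdCV_apply, rdG_0, rdG_1, rdG_2, rdG_3, rd_pt3_0, rd_pt3_1, rd_pt3_2]) (by norm_num [rdCV_apply, rdG_0, rdG_1, rdG_2, rdG_3, rd_pt3_0, rd_pt3_1, rd_pt3_2])).symm
  · refine convexHull_min ?_ (convex_convexHull ℝ _)
    have e : ∀ (ε δ : ℝ) (y : EucSp 3), (ε = 1 ∨ ε = -1) → (δ = 1 ∨ δ = -1) →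
        (y = pt3 ε δ 0 ∨ y = pt3 ε 0 δ ∨ y = pt3 0 ε δ) → y ∈ Cuboctahedron :=
      fun ε δ y h1 h2 h3 => subset_convexHull ℝ _ ⟨ε, δ, h1, h2, h3⟩
    have self : ∀ i, rdCV (i, i) ∈ Cuboctahedron := by
      intro i; simpa [rdCV] using hz
    rintro _ ⟨⟨i, j⟩, rfl⟩
    fin_cases i <;> fin_cases j
    · exact self 0
    · refine e 1 1 (rdCV (0, 1)) (by simp) (by simp) (.inr (.inr (rd_p3 _ _ _ _ ?_ ?_ ?_))) <;>
        norm_num [rdCV_apply, rdG_0, rdG_1, rdG_2, rdG_3, rd_pt3_0, rd_pt3_1, rd_pt3_2]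
    · refine e 1 1 (rdCV (0, 2)) (by simp) (by simp) (.inr (.inl (rd_p3 _ _ _ _ ?_ ?_ ?_))) <;>
        norm_num [rdCV_apply, rdG_0, rdG_1, rdG_2, rdG_3, rd_pt3_0, rd_pt3_1, rd_pt3_2]
    · refine e 1 1 (rdCV (0, 3)) (by simp) (by simp) (.inl (rd_p3 _ _ _ _ ?_ ?_ ?_)) <;>
        norm_num [rdCV_apply, rdG_0, rdG_1, rdG_2, rdG_3, rd_pt3_0, rd_pt3_1, rd_pt3_2]
    · refine e (-1) (-1) (rdCV (1, 0)) (by simp) (by simp) (.inr (.inr (rd_p3 _ _ _ _ ?_ ?_ ?_))) <;>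
        norm_num [rdCV_apply, rdG_0, rdG_1, rdG_2, rdG_3, rd_pt3_0, rd_pt3_1, rd_pt3_2]
    · exact self 1
    · refine e 1 (-1) (rdCV (1, 2)) (by simp) (by simp) (.inl (rd_p3 _ _ _ _ ?_ ?_ ?_)) <;>
        norm_num [rdCV_apply, rdG_0, rdG_1, rdG_2, rdG_3, rd_pt3_0, rd_pt3_1, rd_pt3_2]
    · refine e 1 (-1) (rdCV (1, 3)) (by simp) (by simp) (.inr (.inl (rd_p3 _ _ _ _ ?_ ?_ ?_))) <;>
        norm_num [rdCV_apply, rdG_0, rdG_1, rdG_2, rdG_3, rd_pt3_0, rd_pt3_1, rd_pt3_2]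
    · refine e (-1) (-1) (rdCV (2, 0)) (by simp) (by simp) (.inr (.inl (rd_p3 _ _ _ _ ?_ ?_ ?_))) <;>
        norm_num [rdCV_apply, rdG_0, rdG_1, rdG_2, rdG_3, rd_pt3_0, rd_pt3_1, rd_pt3_2]
    · refine e (-1) 1 (rdCV (2, 1)) (by simp) (by simp) (.inl (rd_p3 _ _ _ _ ?_ ?_ ?_)) <;>
        norm_num [rdCV_apply, rdG_0, rdG_1, rdG_2, rdG_3, rd_pt3_0, rd_pt3_1, rd_pt3_2]
    · exact self 2
    · refine e 1 (-1) (rdCV (2, 3)) (by simp) (by simp) (.inr (.inr (rd_p3 _ _ _ _ ?_ ?_ ?_))) <;>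
        norm_num [rdCV_apply, rdG_0, rdG_1, rdG_2, rdG_3, rd_pt3_0, rd_pt3_1, rd_pt3_2]
    · refine e (-1) (-1) (rdCV (3, 0)) (by simp) (by simp) (.inl (rd_p3 _ _ _ _ ?_ ?_ ?_)) <;>
        norm_num [rdCV_apply, rdG_0, rdG_1, rdG_2, rdG_3, rd_pt3_0, rd_pt3_1, rd_pt3_2]
    · refine e (-1) 1 (rdCV (3, 1)) (by simp) (by simp) (.inr (.inl (rd_p3 _ _ _ _ ?_ ?_ ?_))) <;>
        norm_num [rdCV_apply, rdG_0, rdG_1, rdG_2, rdG_3, rd_pt3_0, rd_pt3_1, rd_pt3_2]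
    · refine e (-1) 1 (rdCV (3, 2)) (by simp) (by simp) (.inr (.inr (rd_p3 _ _ _ _ ?_ ?_ ?_))) <;>
        norm_num [rdCV_apply, rdG_0, rdG_1, rdG_2, rdG_3, rd_pt3_0, rd_pt3_1, rd_pt3_2]
    · exact self 3

theorem rd_rhombic_hull : RhombicDodecahedron = convexHull ℝ (Set.range rdRV) := by
  have key : ∀ a b c : ℝ, -pt3 a b c = pt3 (-a) (-b) (-c) := by
    intro a b c; ext i; fin_cases i <;> simp [pt3]
  have hz : (0 : EucSp 3) ∈ RhombicDodecahedron := by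
    apply rd_zero_mem (x := pt3 1 1 1)
    · exact .inl ⟨1, 1, 1, by simp, by simp, by simp, rfl⟩
    · exact .inl ⟨-1, -1, -1, by simp, by simp, by simp, by simp [key]⟩
  have val : ∀ B, rdRV B = (if B 0 then rdG 0 else 0) + (if B 1 then rdG 1 else 0) +
      (if B 2 then rdG 2 else 0) + (if B 3 then rdG 3 else 0) := by
    intro B; simp only [rdRV, Fin.sum_univ_four]
  apply Set.Subset.antisymm
  · apply convexHull_mono
    have e : ∀ (b0 b1 b2 b3 : Bool) (y : EucSp 3), (if b0 then rdG 0 else 0) +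
        (if b1 then rdG 1 else 0) + (if b2 then rdG 2 else 0) + (if b3 then rdG 3 else 0) = y →
        y ∈ Set.range rdRV :=
      fun b0 b1 b2 b3 y h => ⟨![b0, b1, b2, b3], by rw [val, ← h]; rfl⟩
    rintro x (⟨ε₁, ε₂, ε₃, h1, h2, h3, rfl⟩ | ⟨ε, hε, hx⟩)
    · rcases h1 with rfl | rfl <;> rcases h2 with rfl | rfl <;> rcases h3 with rfl | rfl
      · apply e true false false false; apply rd_p3 <;> norm_num [val, rdG_0, rdG_1, rdG_2, rdG_3, rd_pt3_0, rd_pt3_1,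
          rd_pt3_2]
      · apply e true true true false; apply rd_p3 <;> norm_num [val, rdG_0, rdG_1, rdG_2, rdG_3, rd_pt3_0, rd_pt3_1,
          rd_pt3_2]
      · apply e true true false true; apply rd_p3 <;> norm_num [val, rdG_0, rdG_1, rdG_2, rdG_3, rd_pt3_0, rd_pt3_1,
          rd_pt3_2]
      · apply e false true false false; apply rd_p3 <;> norm_num [val, rdG_0, rdG_1, rdG_2, rdG_3, rd_pt3_0, rd_pt3_1,
          rd_pt3_2]
      · apply e true false true true; apply rd_p3 <;> norm_num [val, rdG_0, rdG_1, rdG_2, rdG_3, rd_pt3_0, rd_pt3_1,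
          rd_pt3_2]
      · apply e false false true false; apply rd_p3 <;> norm_num [val, rdG_0, rdG_1, rdG_2, rdG_3, rd_pt3_0, rd_pt3_1,
          rd_pt3_2]
      · apply e false false false true; apply rd_p3 <;> norm_num [val, rdG_0, rdG_1, rdG_2, rdG_3, rd_pt3_0, rd_pt3_1,
          rd_pt3_2]
      · apply e false true true true; apply rd_p3 <;> norm_num [val, rdG_0, rdG_1, rdG_2, rdG_3, rd_pt3_0, rd_pt3_1,
          rd_pt3_2]
    · rcases hε with rfl | rfl <;> rcases hx with rfl | rfl | rfl
      · apply e true true false false; apply rd_p3 <;> norm_num [val, rdG_0, rdG_1, rdG_2, rdG_3, rd_pt3_0, rd_pt3_1,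
          rd_pt3_2]
      · apply e true false true false; apply rd_p3 <;> norm_num [val, rdG_0, rdG_1, rdG_2, rdG_3, rd_pt3_0, rd_pt3_1,
          rd_pt3_2]
      · apply e true false false true; apply rd_p3 <;> norm_num [val, rdG_0, rdG_1, rdG_2, rdG_3, rd_pt3_0, rd_pt3_1,
          rd_pt3_2]
      · apply e false false true true; apply rd_p3 <;> norm_num [val, rdG_0, rdG_1, rdG_2, rdG_3, rd_pt3_0, rd_pt3_1,
          rd_pt3_2]
      · apply e false true false true; apply rd_p3 <;> norm_num [val, rdG_0, rdG_1, rdG_2, rdG_3, rd_pt3_0, rd_pt3_1,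
          rd_pt3_2]
      · apply e false true true false; apply rd_p3 <;> norm_num [val, rdG_0, rdG_1, rdG_2, rdG_3, rd_pt3_0, rd_pt3_1,
          rd_pt3_2]
  · refine convexHull_min ?_ (convex_convexHull ℝ _)
    have e1 : ∀ (a b c : ℝ) (y : EucSp 3), (a = 1 ∨ a = -1) → (b = 1 ∨ b = -1) →
        (c = 1 ∨ c = -1) → y = pt3 a b c → y ∈ RhombicDodecahedron :=
      fun a b c y h1 h2 h3 h => subset_convexHull ℝ _ (.inl ⟨a, b, c, h1, h2, h3, h⟩)
    have e2 : ∀ (a : ℝ) (y : EucSp 3), (a = 2 ∨ a = -2) →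
        (y = pt3 a 0 0 ∨ y = pt3 0 a 0 ∨ y = pt3 0 0 a) → y ∈ RhombicDodecahedron :=
      fun a y h1 h => subset_convexHull ℝ _ (.inr ⟨a, h1, h⟩)
    rintro _ ⟨B, rfl⟩
    rw [val]
    rcases h0 : B 0 with _ | _ <;> rcases h1 : B 1 with _ | _ <;>
      rcases h2 : B 2 with _ | _ <;> rcases h3 : B 3 with _ | _
    · simpa using hz
    · refine e1 (-1) (-1) 1 _ (by simp) (by simp) (by simp) (rd_p3 _ _ _ _ ?_ ?_ ?_) <;>
        norm_num [PiLp.add_apply, rdG_0, rdG_1, rdG_2, rdG_3, rd_pt3_0, rd_pt3_1, rd_pt3_2]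
    · refine e1 (-1) 1 (-1) _ (by simp) (by simp) (by simp) (rd_p3 _ _ _ _ ?_ ?_ ?_) <;>
        norm_num [PiLp.add_apply, rdG_0, rdG_1, rdG_2, rdG_3, rd_pt3_0, rd_pt3_1, rd_pt3_2]
    · refine e2 (-2) _ (by simp) (.inl (rd_p3 _ _ _ _ ?_ ?_ ?_)) <;> norm_num [PiLp.add_apply, rdG_0, rdG_1, rdG_2, rdG_3, rd_pt3_0, rd_pt3_1, rd_pt3_2]
    · refine e1 1 (-1) (-1) _ (by simp) (by simp) (by simp) (rd_p3 _ _ _ _ ?_ ?_ ?_) <;>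
        norm_num [PiLp.add_apply, rdG_0, rdG_1, rdG_2, rdG_3, rd_pt3_0, rd_pt3_1, rd_pt3_2]
    · refine e2 (-2) _ (by simp) (.inr (.inl (rd_p3 _ _ _ _ ?_ ?_ ?_))) <;> norm_num [PiLp.add_apply, rdG_0, rdG_1, rdG_2, rdG_3, rd_pt3_0, rd_pt3_1, rd_pt3_2]
    · refine e2 (-2) _ (by simp) (.inr (.inr (rd_p3 _ _ _ _ ?_ ?_ ?_))) <;> norm_num [PiLp.add_apply, rdG_0, rdG_1, rdG_2, rdG_3, rd_pt3_0, rd_pt3_1, rd_pt3_2]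
    · refine e1 (-1) (-1) (-1) _ (by simp) (by simp) (by simp) (rd_p3 _ _ _ _ ?_ ?_ ?_) <;>
        norm_num [PiLp.add_apply, rdG_0, rdG_1, rdG_2, rdG_3, rd_pt3_0, rd_pt3_1, rd_pt3_2]
    · refine e1 1 1 1 _ (by simp) (by simp) (by simp) (rd_p3 _ _ _ _ ?_ ?_ ?_) <;>
        norm_num [PiLp.add_apply, rdG_0, rdG_1, rdG_2, rdG_3, rd_pt3_0, rd_pt3_1, rd_pt3_2]
    · refine e2 2 _ (by simp) (.inr (.inr (rd_p3 _ _ _ _ ?_ ?_ ?_))) <;> norm_num [PiLp.add_apply, rdG_0, rdG_1, rdG_2, rdG_3, rd_pt3_0, rd_pt3_1, rd_pt3_2]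
    · refine e2 2 _ (by simp) (.inr (.inl (rd_p3 _ _ _ _ ?_ ?_ ?_))) <;> norm_num [PiLp.add_apply, rdG_0, rdG_1, rdG_2, rdG_3, rd_pt3_0, rd_pt3_1, rd_pt3_2]
    · refine e1 (-1) 1 1 _ (by simp) (by simp) (by simp) (rd_p3 _ _ _ _ ?_ ?_ ?_) <;>
        norm_num [PiLp.add_apply, rdG_0, rdG_1, rdG_2, rdG_3, rd_pt3_0, rd_pt3_1, rd_pt3_2]
    · refine e2 2 _ (by simp) (.inl (rd_p3 _ _ _ _ ?_ ?_ ?_)) <;> norm_num [PiLp.add_apply, rdG_0, rdG_1, rdG_2, rdG_3, rd_pt3_0, rd_pt3_1, rd_pt3_2]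
    · refine e1 1 (-1) 1 _ (by simp) (by simp) (by simp) (rd_p3 _ _ _ _ ?_ ?_ ?_) <;>
        norm_num [PiLp.add_apply, rdG_0, rdG_1, rdG_2, rdG_3, rd_pt3_0, rd_pt3_1, rd_pt3_2]
    · refine e1 1 1 (-1) _ (by simp) (by simp) (by simp) (rd_p3 _ _ _ _ ?_ ?_ ?_) <;>
        norm_num [PiLp.add_apply, rdG_0, rdG_1, rdG_2, rdG_3, rd_pt3_0, rd_pt3_1, rd_pt3_2]
    · simp only [if_true, rdG_sum]; exact hz

theorem rd_cubocta_iso : Nonempty (RDModel ≃o Faces Cuboctahedron) := by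
  rw [rd_cubocta_hull]
  have arg : ∀ (l : StrongDual ℝ (EucSp 3)),
      {i : Fin 4 × Fin 4 | ∀ j, l (rdCV j) ≤ l (rdCV i)} =
        {i | (∀ k, l (rdG k) ≤ l (rdG i.1)) ∧ (∀ k, l (rdG i.2) ≤ l (rdG k))} := by
    intro l
    ext ⟨i, j⟩
    simp only [Set.mem_ofPred_eq, rdCV, map_smul, map_sub, smul_eq_mul]
    constructor
    · intro h
      exact ⟨fun k => by have := h (k, j); simp only at this; linarith,
        fun k => by have := h (i, k); simp only at this; linarith⟩
    · rintro ⟨h1, h2⟩ ⟨i', j'⟩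
      have := h1 i'
      have := h2 j'
      simp only
      linarith
  refine rd_faces_iso rdCV
    (fun x : RDModel => {p | x.1.testBit p.1 ∧ x.1.testBit (4 + p.2)}) ?_ ?_ ?_ ?_
  · intro x y
    rw [rd_model_le_iff, rd_model_bits _ x.2 _ y.2]
    constructor
    · rintro h ⟨i, j⟩ ⟨h1, h2⟩
      exact ⟨(h i).1 h1, (h j).2 h2⟩
    · intro h i
      rcases rd_model_nonempty _ x.2 with h0 | ⟨⟨a, ha⟩, ⟨c, hc⟩⟩
      · simp [h0]
      · exact ⟨fun hi => (@h (i, c) ⟨hi, hc⟩).1, fun hi => (@h (a, i) ⟨ha, hi⟩).2⟩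
  · intro x
    by_cases h0 : x.1 = 0
    · left; ext p; simp [h0]
    · right
      obtain ⟨l, hl⟩ := rdG_functional (fun i => (rdW x.1 i : ℝ))
      refine ⟨l, ?_⟩
      rw [arg]
      ext ⟨i, j⟩
      have hw := rd_model_weight _ x.2 h0
      simp only [Set.mem_ofPred_eq, hl]
      rw [(hw i).1, (hw j).2]
      refine and_congr (forall_congr' fun k => ?_) (forall_congr' fun k => ?_)
      · rw [← Int.cast_le (R := ℝ)]; constructor <;> intro h <;> linarith
      · rw [← Int.cast_le (R := ℝ)]; constructor <;> intro h <;> linarith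
  · intro l
    obtain ⟨x, hx, h⟩ := rd_model_exists (fun i => decide (∀ k, l (rdG k) ≤ l (rdG i)))
      (fun i => decide (∀ k, l (rdG i) ≤ l (rdG k))) (by
        simp only [decide_eq_true_eq]
        by_cases hc : ∃ i, (∀ k, l (rdG k) ≤ l (rdG i)) ∧ (∀ k, l (rdG i) ≤ l (rdG k))
        · right
          obtain ⟨i, h1, h2⟩ := hc
          have : ∀ k, l (rdG k) = l (rdG i) := fun k => le_antisymm (h1 k) (h2 k)
          intro j
          simp [this]
        · left
          refine ⟨?_, fun i hi => hc ⟨i, hi⟩⟩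
          obtain ⟨a, ha⟩ := Finite.exists_max (fun i => l (rdG i))
          obtain ⟨b, hb⟩ := Finite.exists_min (fun i => l (rdG i))
          exact ⟨fun _ => ⟨b, hb⟩, fun _ => ⟨a, ha⟩⟩)
    refine ⟨⟨x, hx⟩, ?_⟩
    rw [arg]
    ext ⟨i, j⟩
    simp [(h i).1, (h j).2]
  · exact ⟨⟨0, by decide⟩, by simp⟩

theorem rd_rhombic_iso : Nonempty (RDModelᵒᵈ ≃o Faces RhombicDodecahedron) := by
  rw [rd_rhombic_hull]
  have arg : ∀ (l : StrongDual ℝ (EucSp 3)),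
      {B : Fin 4 → Bool | ∀ B', l (rdRV B') ≤ l (rdRV B)} =
        {B | ∀ i, (0 < l (rdG i) → B i) ∧ (l (rdG i) < 0 → ¬ B i)} := by
    intro l
    have val : ∀ B, l (rdRV B) = ∑ i, if B i then l (rdG i) else 0 := by
      intro B
      simp only [rdRV, map_sum]
      refine Finset.sum_congr rfl fun i _ => ?_
      split_ifs <;> simp
    ext B
    simp only [Set.mem_ofPred_eq, val]
    constructor
    · intro h i
      have key : ∀ b : Bool, (if b then l (rdG i) else 0) ≤ if B i then l (rdG i) else 0 := by
        intro b
        have := h (Function.update B i b)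
        rw [← Finset.add_sum_erase _ _ (Finset.mem_univ i),
          ← Finset.add_sum_erase (Finset.univ) (fun i => if B i then l (rdG i) else 0)
            (Finset.mem_univ i)] at this
        have e : ∑ x ∈ Finset.univ.erase i,
            (if Function.update B i b x then l (rdG x) else 0) =
            ∑ x ∈ Finset.univ.erase i, (if B x then l (rdG x) else 0) := by
          refine Finset.sum_congr rfl fun x hx => ?_
          rw [Function.update_of_ne (Finset.ne_of_mem_erase hx)]
        rw [e, Function.update_self] at this
        linarith
      constructor
      · intro hp
        by_contra hB
        have := key true
        simp [hB] at this
        linarith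
      · intro hp hB
        have := key false
        simp [hB] at this
        linarith
    · intro h B'
      refine Finset.sum_le_sum fun i _ => ?_
      rcases lt_trichotomy (l (rdG i)) 0 with hi | hi | hi
      · have := (h i).2 hi
        rw [if_neg this]
        split_ifs <;> linarith
      · simp [hi]
      · have := (h i).1 hi
        rw [if_pos this]
        split_ifs <;> linarith
  refine rd_faces_iso rdRV
    (fun x : RDModelᵒᵈ => {B | ∀ i : Fin 4, ((OrderDual.ofDual x).1.testBit i → B i) ∧
      ((OrderDual.ofDual x).1.testBit (4 + i) → ¬ B i)}) ?_ ?_ ?_ ?_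
  · intro y x
    induction y using OrderDual.rec with | toDual y => ?_
    induction x using OrderDual.rec with | toDual x => ?_
    rw [OrderDual.toDual_le_toDual, rd_model_le_iff, rd_model_bits _ x.2 _ y.2]
    simp only [OrderDual.ofDual_toDual]
    constructor
    · intro h B hB i
      exact ⟨fun hi => (hB i).1 ((h i).1 hi), fun hi => (hB i).2 ((h i).2 hi)⟩
    · intro h i
      rcases rd_model_disjoint _ y.2 with h0 | h0
      · have h255 : ∀ i : Fin 4, Nat.testBit 255 i ∧ Nat.testBit 255 (4 + i) := by decide
        rw [h0]
        exact ⟨fun _ => (h255 i).1, fun _ => (h255 i).2⟩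
      · constructor
        · intro hi
          have := (@h (fun j => y.1.testBit j) (fun j => ⟨id, fun hj hj' => h0 j ⟨hj', hj⟩⟩) i).1 hi
          exact this
        · intro hi
          have := (@h (fun j => !y.1.testBit (4 + j))
            (fun j => ⟨fun hj => by have := h0 j; simp_all, fun hj => by simp_all⟩) i).2 hi
          simpa using this
  · intro x
    induction x using OrderDual.rec with | toDual x => ?_
    simp only [OrderDual.ofDual_toDual]
    by_cases h0 : x.1 = 255
    · left
      ext B
      simp only [h0, Set.mem_ofPred_eq, Set.mem_empty_iff_false, iff_false]
      intro h
      exact (h 0).2 (by decide) ((h 0).1 (by decide))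
    · right
      obtain ⟨l, hl⟩ := rdG_functional (fun i => (rdW' x.1 i : ℝ))
      refine ⟨l, ?_⟩
      rw [arg]
      obtain ⟨hs, hw⟩ := rd_model_weight' _ x.2 h0
      have hs' : (rdW' x.1 0 + rdW' x.1 1 + rdW' x.1 2 + rdW' x.1 3 : ℝ) = 0 := by
        exact_mod_cast hs
      ext B
      simp only [Set.mem_ofPred_eq, hl, hs', sub_zero]
      refine forall_congr' fun i => ?_
      rw [(hw i).1, (hw i).2, ← Int.cast_pos (R := ℝ), ← Int.cast_lt_zero (R := ℝ)]
      have e1 : (0 : ℝ) < 4 * (rdW' x.1 i : ℝ) ↔ (0 : ℝ) < rdW' x.1 i := by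
        constructor <;> intro h <;> linarith
      have e2 : 4 * (rdW' x.1 i : ℝ) < 0 ↔ (rdW' x.1 i : ℝ) < 0 := by
        constructor <;> intro h <;> linarith
      rw [e1, e2]
  · intro l
    have hsum : l (rdG 0) + l (rdG 1) + l (rdG 2) + l (rdG 3) = 0 := by
      rw [← map_add, ← map_add, ← map_add, rdG_sum, map_zero]
    have hs4 : ∑ i, l (rdG i) = 0 := by rw [Fin.sum_univ_four]; exact hsum
    obtain ⟨x, hx, h⟩ := rd_model_exists (fun i => decide (0 < l (rdG i)))
      (fun i => decide (l (rdG i) < 0)) (by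
        simp only [decide_eq_true_eq]
        left
        refine ⟨⟨?_, ?_⟩, fun i hi => by linarith [hi.1, hi.2]⟩
        · rintro ⟨i, hi⟩
          by_contra! hc
          have := Finset.sum_pos' (fun j _ => hc j) ⟨i, Finset.mem_univ i, hi⟩
          linarith
        · rintro ⟨i, hi⟩
          by_contra! hc
          have := Finset.sum_neg' (fun j _ => hc j) ⟨i, Finset.mem_univ i, hi⟩
          linarith)
    refine ⟨OrderDual.toDual (⟨x, hx⟩ : RDModel), ?_⟩
    rw [arg]
    ext B
    refine forall_congr' fun i => ?_
    change ((x.testBit i = true → _) ∧ (x.testBit (4 + i) = true → _)) ↔ _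
    rw [(h i).1, (h i).2]
    simp only [decide_eq_true_eq]
  · refine ⟨OrderDual.toDual (⟨255, by decide⟩ : RDModel), ?_⟩
    ext B
    simp only [OrderDual.ofDual_toDual, Set.mem_ofPred_eq, Set.mem_empty_iff_false, iff_false]
    intro h
    exact (h 0).2 (by decide) ((h 0).1 (by decide))

end RDIsos

section RDTransport

/-- The rank in the model (shifted so that the least element has rank `0`). -/
def rdRk (n : ℕ) : ℕ :=
  if n = 0 then 0 else if n = 255 then 4 else
    (n.testBit 0).toNat + (n.testBit 1).toNat + (n.testBit 2).toNat + (n.testBit 3).toNat +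
    (n.testBit 4).toNat + (n.testBit 5).toNat + (n.testBit 6).toNat + (n.testBit 7).toNat - 1

/-- Strict order on codes. -/
def rdLt (m n : ℕ) : Bool := decide (m &&& n = m ∧ m ≠ n)

/-- Adjacency in the model of the vertices `x`, `m` inside the quadrilateral `q`. -/
def rdAdj (x q m : ℕ) : Bool :=
  decide (m ≠ x) && rdCodes.any (fun e => decide (rdRk e = 2) && rdLt e x && rdLt e m && rdLt q e)

/-- Cyclic lists of faces and neighbours around a vertex of degree four. -/
def rdTab4 : List ((Fin 4 → ℕ) × (Fin 4 → ℕ)) :=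
  [(![20, 24, 40, 36], ![180, 30, 120, 45]),
   (![18, 24, 72, 66], ![210, 30, 120, 75]),
   (![33, 40, 72, 65], ![225, 45, 120, 75]),
   (![18, 20, 132, 130], ![210, 30, 180, 135]),
   (![33, 36, 132, 129], ![225, 45, 180, 135]),
   (![65, 66, 130, 129], ![225, 75, 210, 135])]

/-- Cyclic lists of vertices and edges of the quadrilaterals. -/
def rdTab5 : List ((Fin 4 → ℕ) × (Fin 4 → ℕ)) :=
  [(![30, 90, 210, 150], ![26, 82, 146, 22]),
   (![30, 60, 180, 150], ![28, 52, 148, 22]),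
   (![30, 60, 120, 90], ![28, 56, 88, 26]),
   (![45, 105, 225, 165], ![41, 97, 161, 37]),
   (![45, 60, 180, 165], ![44, 52, 164, 37]),
   (![45, 60, 120, 105], ![44, 56, 104, 41]),
   (![75, 105, 225, 195], ![73, 97, 193, 67]),
   (![75, 90, 210, 195], ![74, 82, 194, 67]),
   (![75, 90, 120, 105], ![74, 88, 104, 73]),
   (![135, 165, 225, 195], ![133, 161, 193, 131]),
   (![135, 150, 210, 195], ![134, 146, 194, 131]),
   (![135, 150, 180, 165], ![134, 148, 164, 133])]

theorem rd_graded_down : ∀ x ∈ rdCodes, 0 < rdRk x →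
    ∃ y ∈ rdCodes, rdLt y x ∧ rdRk y + 1 = rdRk x := by
  decide +kernel

theorem rd_graded_up : ∀ x ∈ rdCodes, rdRk x < 4 →
    ∃ y ∈ rdCodes, rdLt x y ∧ rdRk y = rdRk x + 1 := by
  decide +kernel

theorem rd_rk_le : ∀ x ∈ rdCodes, rdRk x ≤ 4 := by
  decide +kernel

theorem rd_codes_nodup : rdCodes.Nodup := by
  decide +kernel

theorem rd_fact_two : ∀ x ∈ rdCodes, rdRk x = 2 →
    (rdCodes.filter (fun y => decide (rdRk y = 3) && rdLt x y)).length = 2 := by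
  decide +kernel

theorem rd_fact_one : ∀ x ∈ rdCodes, rdRk x = 2 →
    (rdCodes.filter (fun y => decide (rdRk y = 3) && rdLt x y &&
      decide ((rdCodes.filter (fun z => decide (rdRk z = 2) && rdLt z y)).length = 4))).length
      = 1 := by
  decide +kernel

theorem rd_fact_twelve : (rdCodes.filter (fun y => decide (rdRk y = 1))).length = 12 := by
  decide +kernel

theorem rd_fact_six : (rdCodes.filter (fun y => decide (rdRk y = 3) &&
      decide ((rdCodes.filter (fun z => decide (rdRk z = 1) && rdLt z y)).length = 4))).length
      = 6 := by
  decide +kernel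

theorem rd_fact_tab4 : ∀ x ∈ rdCodes, rdRk x = 3 →
    (rdCodes.filter (fun z => decide (rdRk z = 1) && rdLt z x)).length = 4 →
    ∃ t ∈ rdTab4, (∀ i, t.1 i ∈ rdCodes ∧ t.2 i ∈ rdCodes ∧ rdRk (t.1 i) = 1 ∧
      rdRk (t.2 i) = 3 ∧ rdLt (t.1 i) x ∧ rdLt (t.1 i) (t.2 i) ∧ rdLt (t.1 i) (t.2 (i + 1)) ∧
      ¬ rdLt (t.1 i) (t.2 (i + 2)) ∧ ¬ rdLt (t.1 i) (t.2 (i + 3))) ∧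
      (∀ i j, t.1 i = t.1 j → i = j) ∧
      (∀ m ∈ rdCodes, rdRk m = 1 → rdLt m x → ∃ i, m = t.1 i) ∧
      (∀ i, ∀ m ∈ rdCodes, rdRk m = 3 →
        (rdAdj x (t.1 i) m ↔ m = t.2 i ∨ m = t.2 (i + 1))) := by
  decide +kernel

theorem rd_fact_tab5 : ∀ q ∈ rdCodes, rdRk q = 1 →
    ∃ t ∈ rdTab5, (∀ i, t.1 i ∈ rdCodes ∧ t.2 i ∈ rdCodes ∧ rdRk (t.1 i) = 3 ∧
      rdRk (t.2 i) = 2 ∧ rdLt q (t.1 i) ∧ rdLt (t.2 i) (t.1 i) ∧ rdLt (t.2 i) (t.1 (i + 1)) ∧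
      ¬ rdLt (t.2 i) (t.1 (i + 2)) ∧ ¬ rdLt (t.2 i) (t.1 (i + 3))) ∧
      (∀ i j, t.1 i = t.1 j → i = j) ∧
      (∀ m ∈ rdCodes, rdRk m = 3 → rdLt q m → ∃ i, m = t.1 i) ∧
      (∀ i, ∀ m ∈ rdCodes, rdRk m = 3 →
        (rdAdj (t.1 i) q m ↔ m = t.1 (i + 3) ∨ m = t.1 (i + 1))) := by
  decide +kernel

theorem rd_lt_model (x y : RDModel) (h : rdLt x.1 y.1) : x < y := by
  simp only [rdLt, decide_eq_true_eq] at h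
  exact lt_of_le_of_ne ((rd_model_le_iff _ _).2 h.1) (fun e => h.2 (congrArg Subtype.val e))

theorem rd_rank_forced (f : RDModel → ℤ) (hf : StrictMono f) (h0 : ∀ x, 0 ≤ f x)
    (h4 : ∀ x, f x ≤ 4) (x : RDModel) : f x = rdRk x.1 := by
  have lo : ∀ k : ℕ, ∀ x : RDModel, rdRk x.1 = k → (k : ℤ) ≤ f x := by
    intro k
    induction k with
    | zero => intro x _; exact_mod_cast h0 x
    | succ k ih =>
      intro x hx
      obtain ⟨y, hy, hlt, hr⟩ := rd_graded_down x.1 x.2 (by omega)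
      have h1 := hf (rd_lt_model ⟨y, hy⟩ x hlt)
      have h2 := ih ⟨y, hy⟩ (by simp only; omega)
      push_cast
      omega
  have hi : ∀ k : ℕ, ∀ x : RDModel, rdRk x.1 + k = 4 → f x ≤ 4 - k := by
    intro k
    induction k with
    | zero => intro x _; have := h4 x; push_cast; omega
    | succ k ih =>
      intro x hx
      obtain ⟨y, hy, hlt, hr⟩ := rd_graded_up x.1 x.2 (by omega)
      have h1 := hf (rd_lt_model x ⟨y, hy⟩ hlt)
      have h2 := ih ⟨y, hy⟩ (by simp only; omega)
      push_cast
      omega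
  have h1 := lo _ x rfl
  have h5 := rd_rk_le _ x.2
  have h2 := hi (4 - rdRk x.1) x (by omega)
  omega

variable {X : Type*} [PartialOrder X] {rk : X → ℤ}

/-- Coordinates on the faces of a facet. -/
structure RDDown (rk : X → ℤ) (F : X) (d : ℕ → X) : Prop where
  le : ∀ n ∈ rdCodes, d n ≤ F
  rk_eq : ∀ n ∈ rdCodes, rk (d n) = 3 - rdRk n
  le_iff : ∀ m ∈ rdCodes, ∀ n ∈ rdCodes, (d m ≤ d n ↔ n &&& m = n)
  surj : ∀ G, G ≤ F → ∃ n ∈ rdCodes, d n = G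

/-- Coordinates on the faces containing a vertex. -/
structure RDUp (rk : X → ℤ) (v : X) (d : ℕ → X) : Prop where
  le : ∀ n ∈ rdCodes, v ≤ d n
  rk_eq : ∀ n ∈ rdCodes, rk (d n) = rdRk n
  le_iff : ∀ m ∈ rdCodes, ∀ n ∈ rdCodes, (d m ≤ d n ↔ m &&& n = m)
  surj : ∀ G, v ≤ G → ∃ n ∈ rdCodes, d n = G

theorem rd_exists_up (hrk : StrictMono rk) (h4 : ∀ x, rk x ≤ 4) (v : X) (hv : rk v = 0)
    (e : RDModel ≃o {G : X // v ≤ G}) : ∃ d, RDUp rk v d := by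
  refine ⟨fun n => if h : n ∈ rdCodes then (e ⟨n, h⟩).1 else v, ?_, ?_, ?_, ?_⟩
  · intro n hn; simp only [hn, dif_pos]; exact (e ⟨n, hn⟩).2
  · intro n hn
    simp only [hn, dif_pos]
    refine rd_rank_forced (fun x => rk (e x).1) ?_ ?_ (fun x => h4 _) ⟨n, hn⟩
    · intro x y hxy
      exact hrk (e.strictMono hxy)
    · intro x
      have := hrk.monotone (e x).2
      change 0 ≤ rk (e x).1
      omega
  · intro m hm n hn
    simp only [hm, hn, dif_pos]
    exact Subtype.coe_le_coe.trans e.le_iff_le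
  · intro G hG
    refine ⟨(e.symm ⟨G, hG⟩).1, (e.symm ⟨G, hG⟩).2, ?_⟩
    rw [dif_pos (e.symm ⟨G, hG⟩).2]
    exact congrArg Subtype.val (e.apply_symm_apply ⟨G, hG⟩)

theorem rd_exists_down (hrk : StrictMono rk) (h1 : ∀ x, -1 ≤ rk x) (F : X) (hF : rk F = 3)
    (e : RDModelᵒᵈ ≃o {G : X // G ≤ F}) : ∃ d, RDDown rk F d := by
  refine ⟨fun n => if h : n ∈ rdCodes then (e (OrderDual.toDual (⟨n, h⟩ : RDModel))).1 else F,
    ?_, ?_, ?_, ?_⟩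
  · intro n hn; simp only [hn, dif_pos]; exact (e _).2
  · intro n hn
    simp only [hn, dif_pos]
    have := rd_rank_forced (fun x => 3 - rk (e (OrderDual.toDual x)).1) ?_ ?_ ?_ ⟨n, hn⟩
    · simp only at this; omega
    · intro x y hxy
      have : rk (e (OrderDual.toDual y)).1 < rk (e (OrderDual.toDual x)).1 :=
        hrk (e.strictMono (OrderDual.toDual_lt_toDual.2 hxy))
      change 3 - rk (e (OrderDual.toDual x)).1 < 3 - rk (e (OrderDual.toDual y)).1
      omega
    · intro x
      have := hrk.monotone (e (OrderDual.toDual x)).2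
      omega
    · intro x
      have := h1 (e (OrderDual.toDual x)).1
      omega
  · intro m hm n hn
    simp only [hm, hn, dif_pos]
    exact Subtype.coe_le_coe.trans e.le_iff_le
  · intro G hG
    refine ⟨(OrderDual.ofDual (e.symm ⟨G, hG⟩)).1, (OrderDual.ofDual (e.symm ⟨G, hG⟩)).2, ?_⟩
    rw [dif_pos (OrderDual.ofDual (e.symm ⟨G, hG⟩)).2]
    exact congrArg Subtype.val (e.apply_symm_apply ⟨G, hG⟩)

theorem RDUp.inj {v : X} {d : ℕ → X} (h : RDUp rk v d) {m n : ℕ} (hm : m ∈ rdCodes)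
    (hn : n ∈ rdCodes) (e : d m = d n) : m = n := by
  have h1 := (h.le_iff m hm n hn).1 e.le
  have h2 := (h.le_iff n hn m hm).1 e.ge
  rw [← h1, Nat.and_comm, h2]

theorem RDDown.inj {v : X} {d : ℕ → X} (h : RDDown rk v d) {m n : ℕ} (hm : m ∈ rdCodes)
    (hn : n ∈ rdCodes) (e : d m = d n) : m = n := by
  have h1 := (h.le_iff m hm n hn).1 e.le
  have h2 := (h.le_iff n hn m hm).1 e.ge
  rw [← h2, Nat.and_comm, h1]

theorem RDUp.lt_iff {v : X} {d : ℕ → X} (h : RDUp rk v d) {m n : ℕ} (hm : m ∈ rdCodes)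
    (hn : n ∈ rdCodes) : d m < d n ↔ rdLt m n := by
  rw [lt_iff_le_and_ne, h.le_iff m hm n hn, rdLt, decide_eq_true_eq]
  refine and_congr_right fun _ => not_congr ⟨h.inj hm hn, fun e => by rw [e]⟩

theorem RDDown.lt_iff {v : X} {d : ℕ → X} (h : RDDown rk v d) {m n : ℕ} (hm : m ∈ rdCodes)
    (hn : n ∈ rdCodes) : d m < d n ↔ rdLt n m := by
  rw [lt_iff_le_and_ne, h.le_iff m hm n hn, rdLt, decide_eq_true_eq]
  refine and_congr_right fun _ => not_congr ⟨fun e => (h.inj hm hn e).symm, fun e => by rw [e]⟩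

theorem rd_card_transport [Fintype X] {d : ℕ → X}
    (inj : ∀ m ∈ rdCodes, ∀ n ∈ rdCodes, d m = d n → m = n) (p : X → Prop) [DecidablePred p] (q : ℕ → Bool)
    (hs : ∀ G, p G → ∃ n ∈ rdCodes, d n = G) (hpq : ∀ n ∈ rdCodes, (p (d n) ↔ q n)) :
    (Finset.univ.filter p).card = (rdCodes.filter q).length := by
  have e : Finset.univ.filter p = ((rdCodes.filter q).toFinset).image d := by
    ext G
    simp only [Finset.mem_filter, Finset.mem_univ, true_and, Finset.mem_image, List.mem_toFinset,
      List.mem_filter]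
    constructor
    · intro hG
      obtain ⟨n, hn, rfl⟩ := hs G hG
      exact ⟨n, ⟨hn, (hpq n hn).1 hG⟩, rfl⟩
    · rintro ⟨n, ⟨hn, hq⟩, rfl⟩
      exact (hpq n hn).2 hq
  rw [e, Finset.card_image_of_injOn, List.toFinset_card_of_nodup (rd_codes_nodup.filter _)]
  intro m hm n hn
  simp only [Finset.mem_coe, List.mem_toFinset, List.mem_filter] at hm hn
  exact inj m hm.1 n hn.1

/-- The vertex `v` has degree four in the facet `F`. -/
def RDT4 [Fintype X] (rk : X → ℤ) (v F : X) : Prop :=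
  (Finset.univ.filter (fun G => rk G = 2 ∧ v < G ∧ G < F)).card = 4

/-- The vertices `v` and `w` are joined by an edge of `Q`. -/
def RDAdjP (rk : X → ℤ) (v Q w : X) : Prop :=
  rk w = 0 ∧ w ≠ v ∧ ∃ E, rk E = 1 ∧ v < E ∧ w < E ∧ E < Q

section Up
set_option linter.unusedSectionVars false
variable [Fintype X] {v : X} {d : ℕ → X}

theorem RDUp.lt_of_rk (h : RDUp rk v d) (hv : rk v = 0) {n : ℕ} (hn : n ∈ rdCodes)
    (h0 : rdRk n ≠ 0) : v < d n := by
  refine lt_of_le_of_ne (h.le n hn) fun e => h0 ?_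
  have := h.rk_eq n hn
  rw [← e, hv] at this
  omega

theorem RDUp.t4_iff (h : RDUp rk v d) (hv : rk v = 0) {n : ℕ} (hn : n ∈ rdCodes) :
    RDT4 rk v (d n) ↔
      (rdCodes.filter (fun z => decide (rdRk z = 2) && rdLt z n)).length = 4 := by
  rw [RDT4, rd_card_transport (d := d) (fun m hm n hn => h.inj hm hn) _
    (fun z => decide (rdRk z = 2) && rdLt z n) (fun G hG => h.surj G hG.2.1.le) ?_]
  intro m hm
  rw [h.rk_eq m hm, h.lt_iff hm hn]
  simp only [Bool.and_eq_true, decide_eq_true_eq]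
  constructor
  · rintro ⟨h1, -, h2⟩; exact ⟨by omega, h2⟩
  · rintro ⟨h1, h2⟩; exact ⟨by omega, h.lt_of_rk hv hm (by omega), h2⟩

theorem RDUp.two (h : RDUp rk v d) {Q : X} (hvQ : v < Q) (hQ : rk Q = 2) :
    (Finset.univ.filter (fun F => rk F = 3 ∧ Q < F)).card = 2 := by
  obtain ⟨x, hx, rfl⟩ := h.surj Q hvQ.le
  rw [rd_card_transport (d := d) (fun m hm n hn => h.inj hm hn) _
    (fun y => decide (rdRk y = 3) && rdLt x y) (fun G hG => h.surj G (hvQ.trans hG.2).le) ?_]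
  · have := h.rk_eq x hx
    exact rd_fact_two x hx (by omega)
  · intro m hm
    rw [h.rk_eq m hm, h.lt_iff hx hm]
    simp only [Bool.and_eq_true, decide_eq_true_eq]
    exact and_congr_left fun _ => by omega

theorem RDUp.one (h : RDUp rk v d) (hv : rk v = 0) {Q : X} (hvQ : v < Q) (hQ : rk Q = 2) :
    (Finset.univ.filter (fun F => rk F = 3 ∧ Q < F ∧ RDT4 rk v F)).card = 1 := by
  obtain ⟨x, hx, rfl⟩ := h.surj Q hvQ.le
  rw [rd_card_transport (d := d) (fun m hm n hn => h.inj hm hn) _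
    (fun y => decide (rdRk y = 3) && rdLt x y &&
      decide ((rdCodes.filter (fun z => decide (rdRk z = 2) && rdLt z y)).length = 4))
    (fun G hG => h.surj G (hvQ.trans hG.2.1).le) ?_]
  · have := h.rk_eq x hx
    exact rd_fact_one x hx (by omega)
  · intro m hm
    rw [h.rk_eq m hm, h.lt_iff hx hm, h.t4_iff hv hm]
    simp only [Bool.and_eq_true, decide_eq_true_eq, and_assoc]
    exact and_congr_left fun _ => by omega

theorem RDUp.exists_facet (h : RDUp rk v d) : ∃ F, rk F = 3 := by
  have h0 : (30 : ℕ) ∈ rdCodes := by decide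
  have h1 : rdRk 30 = 3 := by decide
  exact ⟨d 30, by rw [h.rk_eq 30 h0, h1]; norm_num⟩

end Up

section Down
set_option linter.unusedSectionVars false
variable [Fintype X] {F : X} {d : ℕ → X}

theorem RDDown.lt_of_rk (h : RDDown rk F d) (hF : rk F = 3) {n : ℕ} (hn : n ∈ rdCodes)
    (h0 : rdRk n ≠ 0) : d n < F := by
  refine lt_of_le_of_ne (h.le n hn) fun e => h0 ?_
  have := h.rk_eq n hn
  rw [e, hF] at this
  omega

theorem RDDown.t4_iff (h : RDDown rk F d) (hF : rk F = 3) {n : ℕ} (hn : n ∈ rdCodes) :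
    RDT4 rk (d n) F ↔
      (rdCodes.filter (fun z => decide (rdRk z = 1) && rdLt z n)).length = 4 := by
  rw [RDT4, rd_card_transport (d := d) (fun m hm n hn => h.inj hm hn) _
    (fun z => decide (rdRk z = 1) && rdLt z n) (fun G hG => h.surj G hG.2.2.le) ?_]
  intro m hm
  rw [h.rk_eq m hm, h.lt_iff hn hm]
  simp only [Bool.and_eq_true, decide_eq_true_eq]
  constructor
  · rintro ⟨h1, h2, -⟩; exact ⟨by omega, h2⟩
  · rintro ⟨h1, h2⟩; exact ⟨by omega, h2, h.lt_of_rk hF hm (by omega)⟩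

theorem RDDown.twelve (h : RDDown rk F d) (hF : rk F = 3) :
    (Finset.univ.filter (fun Q => rk Q = 2 ∧ Q < F)).card = 12 := by
  rw [rd_card_transport (d := d) (fun m hm n hn => h.inj hm hn) _
    (fun y => decide (rdRk y = 1)) (fun G hG => h.surj G hG.2.le) ?_]
  · exact rd_fact_twelve
  · intro m hm
    rw [h.rk_eq m hm]
    simp only [decide_eq_true_eq]
    constructor
    · rintro ⟨h1, -⟩; omega
    · intro h1; exact ⟨by omega, h.lt_of_rk hF hm (by omega)⟩

theorem RDDown.six (h : RDDown rk F d) (hF : rk F = 3) :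
    (Finset.univ.filter (fun v => rk v = 0 ∧ v < F ∧ RDT4 rk v F)).card = 6 := by
  rw [rd_card_transport (d := d) (fun m hm n hn => h.inj hm hn) _
    (fun y => decide (rdRk y = 3) &&
      decide ((rdCodes.filter (fun z => decide (rdRk z = 1) && rdLt z y)).length = 4))
    (fun G hG => h.surj G hG.2.1.le) ?_]
  · exact rd_fact_six
  · intro m hm
    rw [h.rk_eq m hm, h.t4_iff hF hm]
    simp only [Bool.and_eq_true, decide_eq_true_eq]
    constructor
    · rintro ⟨h1, -, h2⟩; exact ⟨by omega, h2⟩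
    · rintro ⟨h1, h2⟩; exact ⟨by omega, h.lt_of_rk hF hm (by omega), h2⟩

theorem RDDown.adj_iff (h : RDDown rk F d) {x q m : ℕ} (hx : x ∈ rdCodes)
    (hq : q ∈ rdCodes) (hm : m ∈ rdCodes) (hm3 : rdRk m = 3) :
    RDAdjP rk (d x) (d q) (d m) ↔ rdAdj x q m := by
  simp only [RDAdjP, rdAdj, Bool.and_eq_true, decide_eq_true_eq, List.any_eq_true, h.rk_eq m hm,
    hm3]
  constructor
  · rintro ⟨-, h1, E, hE, h2, h3, h4⟩
    obtain ⟨e, he, rfl⟩ := h.surj E (h4.le.trans (h.le q hq))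
    rw [h.lt_iff hx he] at h2
    rw [h.lt_iff hm he] at h3
    rw [h.lt_iff he hq] at h4
    rw [h.rk_eq e he] at hE
    exact ⟨fun e => h1 (by rw [e]), e, he, ⟨⟨by omega, h2⟩, h3⟩, h4⟩
  · rintro ⟨h1, e, he, ⟨⟨hE, h2⟩, h3⟩, h4⟩
    refine ⟨by norm_num, fun e => h1 (h.inj hm hx e), d e, ?_, (h.lt_iff hx he).2 h2,
      (h.lt_iff hm he).2 h3, (h.lt_iff he hq).2 h4⟩
    rw [h.rk_eq e he]; omega

theorem RDDown.around (h : RDDown rk F d) (hF : rk F = 3) {v : X} (hv : rk v = 0) (hvF : v < F)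
    (ht : RDT4 rk v F) : ∃ Q w : Fin 4 → X,
      (∀ i, rk (Q i) = 2 ∧ rk (w i) = 0 ∧ v < Q i ∧ Q i < F ∧ w i < Q i ∧ w (i + 1) < Q i ∧
        ¬ w (i + 2) < Q i ∧ ¬ w (i + 3) < Q i) ∧
      Function.Injective Q ∧ (∀ G, rk G = 2 → v < G → G < F → ∃ i, G = Q i) ∧
      (∀ i u, RDAdjP rk v (Q i) u ↔ u = w i ∨ u = w (i + 1)) := by
  obtain ⟨x, hx, rfl⟩ := h.surj v hvF.le
  rw [h.t4_iff hF hx] at ht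
  have hx3 : rdRk x = 3 := by have := h.rk_eq x hx; omega
  obtain ⟨t, -, h1, h2, h3, h4⟩ := rd_fact_tab4 x hx hx3 ht
  refine ⟨fun i => d (t.1 i), fun i => d (t.2 i), ?_, ?_, ?_, ?_⟩
  · intro i
    obtain ⟨a1, a2, a3, a4, a5, a6, a7, a8, a9⟩ := h1 i
    simp only [h.rk_eq _ a1, h.rk_eq _ a2, a3, a4, h.lt_iff hx a1, h.lt_iff a2 a1,
      h.lt_iff (h1 _).2.1 a1, a5, a6, a7]
    refine ⟨by norm_num, by norm_num, trivial, h.lt_of_rk hF a1 (by omega), trivial, trivial,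
      a8, a9⟩
  · intro i j hij
    exact h2 i j (h.inj (h1 i).1 (h1 j).1 hij)
  · intro G hG hvG hGF
    obtain ⟨m, hm, rfl⟩ := h.surj G hGF.le
    rw [h.lt_iff hx hm] at hvG
    rw [h.rk_eq m hm] at hG
    obtain ⟨i, hi⟩ := h3 m hm (by omega) hvG
    exact ⟨i, by rw [hi]⟩
  · intro i u
    have key : ∀ m ∈ rdCodes, rdRk m = 3 → (RDAdjP rk (d x) (d (t.1 i)) (d m) ↔
        d m = d (t.2 i) ∨ d m = d (t.2 (i + 1))) := by
      intro m hm hm3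
      rw [h.adj_iff hx (h1 i).1 hm hm3, h4 i m hm hm3]
      refine or_congr ⟨fun e => by rw [e], h.inj hm (h1 _).2.1⟩
        ⟨fun e => by rw [e], h.inj hm (h1 _).2.1⟩
    constructor
    · intro hu
      obtain ⟨hu0, -, E, -, -, h5, h6⟩ := id hu
      obtain ⟨m, hm, rfl⟩ := h.surj u ((h5.trans h6).le.trans (h.le _ (h1 i).1))
      rw [h.rk_eq m hm] at hu0
      exact (key m hm (by omega)).1 hu
    · rintro (rfl | rfl)
      · exact (key _ (h1 _).2.1 (h1 _).2.2.2.1).2 (.inl rfl)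
      · exact (key _ (h1 _).2.1 (h1 _).2.2.2.1).2 (.inr rfl)

theorem RDDown.quad (h : RDDown rk F d) {Q : X} (hQ : rk Q = 2) (hQF : Q < F) :
    ∃ x E : Fin 4 → X,
      (∀ i, rk (x i) = 0 ∧ rk (E i) = 1 ∧ x i < Q ∧ x i < E i ∧ x (i + 1) < E i ∧
        ¬ x (i + 2) < E i ∧ ¬ x (i + 3) < E i) ∧
      Function.Injective x ∧ (∀ u, rk u = 0 → u < Q → ∃ i, u = x i) ∧
      (∀ i u, RDAdjP rk (x i) Q u ↔ u = x (i + 3) ∨ u = x (i + 1)) := by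
  obtain ⟨q, hq, rfl⟩ := h.surj Q hQF.le
  have hq3 : rdRk q = 1 := by have := h.rk_eq q hq; omega
  obtain ⟨t, -, h1, h2, h3, h4⟩ := rd_fact_tab5 q hq hq3
  refine ⟨fun i => d (t.1 i), fun i => d (t.2 i), ?_, ?_, ?_, ?_⟩
  · intro i
    obtain ⟨a1, a2, a3, a4, a5, a6, a7, a8, a9⟩ := h1 i
    simp only [h.rk_eq _ a1, h.rk_eq _ a2, a3, a4, h.lt_iff a1 hq, h.lt_iff a1 a2,
      h.lt_iff (h1 _).1 a2, a5, a6, a7]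
    exact ⟨by norm_num, by norm_num, trivial, trivial, trivial, a8, a9⟩
  · intro i j hij
    exact h2 i j (h.inj (h1 i).1 (h1 j).1 hij)
  · intro u hu huQ
    obtain ⟨m, hm, rfl⟩ := h.surj u (huQ.trans hQF).le
    rw [h.lt_iff hm hq] at huQ
    rw [h.rk_eq m hm] at hu
    obtain ⟨i, hi⟩ := h3 m hm (by omega) huQ
    exact ⟨i, by rw [hi]⟩
  · intro i u
    have key : ∀ m ∈ rdCodes, rdRk m = 3 → (RDAdjP rk (d (t.1 i)) (d q) (d m) ↔
        d m = d (t.1 (i + 3)) ∨ d m = d (t.1 (i + 1))) := by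
      intro m hm hm3
      rw [h.adj_iff (h1 i).1 hq hm hm3, h4 i m hm hm3]
      refine or_congr ⟨fun e => by rw [e], h.inj hm (h1 _).1⟩
        ⟨fun e => by rw [e], h.inj hm (h1 _).1⟩
    constructor
    · intro hu
      obtain ⟨hu0, -, E, -, -, h5, h6⟩ := id hu
      obtain ⟨m, hm, rfl⟩ := h.surj u ((h5.trans h6).le.trans (h.le _ hq))
      rw [h.rk_eq m hm] at hu0
      exact (key m hm (by omega)).1 hu
    · rintro (rfl | rfl)
      · exact (key _ (h1 _).1 (h1 _).2.2.1).2 (.inl rfl)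
      · exact (key _ (h1 _).1 (h1 _).2.2.1).2 (.inr rfl)

end Down

end RDTransport

section RDFinal

theorem rd_count {X : Type*} [PartialOrder X] (V Q F : Finset X) (t : X → X → Prop)
    (θ : X → X → ℝ) (hF : F.Nonempty)
    (h12 : ∀ f ∈ F, (Q.filter (fun q => q < f)).card = 12)
    (h2 : ∀ q ∈ Q, (F.filter (fun f => q < f)).card = 2)
    (h6 : ∀ f ∈ F, (V.filter (fun v => v < f ∧ t v f)).card = 6)
    (h1 : ∀ q ∈ Q, ∀ v ∈ V, v < q → (F.filter (fun f => q < f ∧ t v f)).card = 1)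
    (hs : ∀ f ∈ F, ∀ v ∈ V, v < f → t v f →
      ∑ q ∈ Q.filter (fun q => v < q ∧ q < f), θ v q < 4 * Real.pi)
    (hq : ∀ q ∈ Q, ∑ v ∈ V.filter (fun v => v < q), θ v q = 4 * Real.pi) : False := by
  have hcard : 12 * F.card = 2 * Q.card := by
    have := Finset.sum_card_bipartiteAbove_eq_sum_card_bipartiteBelow (s := F) (t := Q)
      (fun f q => q < f)
    have e1 : ∑ f ∈ F, (Finset.bipartiteAbove (fun f q => q < f) Q f).card = ∑ f ∈ F, 12 :=
      Finset.sum_congr rfl (fun f hf => h12 f hf)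
    have e2 : ∑ q ∈ Q, (Finset.bipartiteBelow (fun f q => q < f) F q).card = ∑ q ∈ Q, 2 :=
      Finset.sum_congr rfl (fun q hq => h2 q hq)
    rw [e1, e2] at this
    simp only [Finset.sum_const, smul_eq_mul] at this
    omega
  have hA : ∑ f ∈ F, ∑ v ∈ V.filter (fun v => v < f ∧ t v f),
      ∑ q ∈ Q.filter (fun q => v < q ∧ q < f), θ v q < ∑ f ∈ F, 6 * (4 * Real.pi) := by
    refine Finset.sum_lt_sum_of_nonempty hF fun f hf => ?_
    have h0 : (V.filter (fun v => v < f ∧ t v f)).Nonempty := by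
      rw [← Finset.card_pos, h6 f hf]; norm_num
    have : (6 : ℝ) * (4 * Real.pi) = ∑ v ∈ V.filter (fun v => v < f ∧ t v f), 4 * Real.pi := by
      rw [Finset.sum_const, h6 f hf, nsmul_eq_mul]; norm_num
    rw [this]
    refine Finset.sum_lt_sum_of_nonempty h0 fun v hv => ?_
    rw [Finset.mem_filter] at hv
    exact hs f hf v hv.1 hv.2.1 hv.2.2
  have hB : ∑ f ∈ F, ∑ v ∈ V.filter (fun v => v < f ∧ t v f),
      ∑ q ∈ Q.filter (fun q => v < q ∧ q < f), θ v q =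
      ∑ q ∈ Q, ∑ v ∈ V.filter (fun v => v < q), θ v q := by
    have e1 : ∑ f ∈ F, ∑ v ∈ V.filter (fun v => v < f ∧ t v f),
        ∑ q ∈ Q.filter (fun q => v < q ∧ q < f), θ v q =
        ∑ f ∈ F, ∑ v ∈ V, ∑ q ∈ Q, if v < q ∧ q < f ∧ t v f then θ v q else 0 := by
      refine Finset.sum_congr rfl fun f _ => ?_
      rw [Finset.sum_filter]
      refine Finset.sum_congr rfl fun v _ => ?_
      split_ifs with h
      · rw [Finset.sum_filter]
        refine Finset.sum_congr rfl fun q _ => ?_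
        simp only [h.2, and_true]
      · symm
        refine Finset.sum_eq_zero fun q _ => if_neg fun h' => h ⟨h'.1.trans h'.2.1, h'.2.2⟩
    have e2 : ∑ f ∈ F, ∑ v ∈ V, ∑ q ∈ Q, (if v < q ∧ q < f ∧ t v f then θ v q else 0) =
        ∑ q ∈ Q, ∑ v ∈ V, ∑ f ∈ F, (if v < q ∧ q < f ∧ t v f then θ v q else 0) := by
      rw [Finset.sum_comm]
      rw [Finset.sum_comm (s := Q)]
      refine Finset.sum_congr rfl fun v _ => ?_
      rw [Finset.sum_comm]
    rw [e1, e2]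
    refine Finset.sum_congr rfl fun q hq => ?_
    rw [Finset.sum_filter]
    refine Finset.sum_congr rfl fun v hv => ?_
    split_ifs with h
    · simp only [h, true_and]
      rw [← Finset.sum_filter, Finset.sum_const, h1 q hq v hv h, one_smul]
    · simp [h]
  rw [hB, Finset.sum_congr rfl hq, Finset.sum_const, Finset.sum_const] at hA
  simp only [nsmul_eq_mul] at hA
  have hcard' : (12 : ℝ) * F.card = 2 * Q.card := by exact_mod_cast hcard
  have hp := Real.pi_pos
  nlinarith

variable {n : ℕ} {P : Set (EucSp n)}

/-- The point of a vertex. -/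
noncomputable def rdPt (v : Faces P) : EucSp n := if h : ∃ x, v.1 = {x} then h.choose else 0

theorem rdPt_spec {v : Faces P} (hv : faceRank v = 0) : v.1 = {rdPt v} := by
  have h := rd_rank_zero v hv
  rw [rdPt, dif_pos h]
  exact h.choose_spec

theorem rdPt_inj {v w : Faces P} (hv : faceRank v = 0) (hw : faceRank w = 0)
    (h : rdPt v = rdPt w) : v = w :=
  Subtype.ext (by rw [rdPt_spec hv, rdPt_spec hw, h])

theorem rdPt_mem {v G : Faces P} (hv : faceRank v = 0) (h : v < G) : rdPt v ∈ G.1 := by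
  have h' : v.1 ⊆ G.1 := h.le
  rw [rdPt_spec hv] at h'
  exact h' rfl

theorem rd_func (G : Faces P) (hG : 0 < faceRank G) : ∃ (l : EucSp n →ₗ[ℝ] ℝ) (m : ℝ),
    ∀ w : Faces P, faceRank w = 0 → (w < G → l (rdPt w) = m) ∧ (¬ w < G → l (rdPt w) < m) := by
  have hne : G.1.Nonempty := by
    rw [Set.nonempty_iff_ne_empty]
    intro h
    rw [faceRank, if_pos h] at hG
    omega
  obtain ⟨l, m, hGP, hle, hiff⟩ := rd_exists_functional G hne
  refine ⟨l.toLinearMap, m, fun w hw => ?_⟩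
  have hwP : rdPt w ∈ P := w.2.subset (by rw [rdPt_spec hw]; rfl)
  constructor
  · intro h
    exact (hiff _ hwP).1 (rdPt_mem hw h)
  · intro h
    refine lt_of_le_of_ne (hle _ hwP) fun e => h ?_
    have hmem := (hiff _ hwP).2 e
    refine lt_of_le_of_ne ?_ fun e' => ?_
    · change w.1 ⊆ G.1
      rw [rdPt_spec hw]
      simpa using hmem
    · rw [← e', hw] at hG; omega

theorem rd_dependent {k : ℕ} {W : Submodule ℝ (EucSp n)} (hW : Module.finrank ℝ W < k)
    (u : Fin k → EucSp n) (hu : ∀ i, u i ∈ W) : ∃ c : Fin k → ℝ, ∑ i, c i • u i = 0 ∧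
      ∃ i, c i ≠ 0 := by
  have h : ¬ LinearIndependent ℝ (fun i => (⟨u i, hu i⟩ : W)) := by
    intro h
    have := h.fintype_card_le_finrank
    rw [Fintype.card_fin] at this
    omega
  rw [Fintype.not_linearIndependent_iff] at h
  obtain ⟨c, hc, hi⟩ := h
  refine ⟨c, ?_, hi⟩
  have := congrArg W.subtype hc
  simpa using this

theorem rd_sub_mem {G : Faces P} {x y : EucSp n} (hx : x ∈ G.1) (hy : y ∈ G.1) :
    x - y ∈ (affineSpan ℝ G.1).direction :=
  AffineSubspace.vsub_mem_direction (subset_affineSpan ℝ _ hx) (subset_affineSpan ℝ _ hy)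

theorem rd_finrank {G : Faces P} {k : ℕ} (h : faceRank G = k) :
    Module.finrank ℝ (affineSpan ℝ G.1).direction = k := by
  rw [faceRank] at h
  split_ifs at h <;> omega

/-- Twice the angle of the polygon `Q` at the vertex `v`. -/
noncomputable def rdTheta [Fintype (Faces P)] (v Q : Faces P) : ℝ :=
  ∑ a ∈ Finset.univ.filter (RDAdjP faceRank v Q), ∑ b ∈ Finset.univ.filter (RDAdjP faceRank v Q),
    EuclideanGeometry.angle (rdPt a) (rdPt v) (rdPt b)

theorem rdTheta_eq [Fintype (Faces P)] {v Q a b : Faces P} (hv : faceRank v = 0) (hab : a ≠ b)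
    (h : ∀ u, RDAdjP faceRank v Q u ↔ u = a ∨ u = b) :
    rdTheta v Q = 2 * EuclideanGeometry.angle (rdPt a) (rdPt v) (rdPt b) := by
  have e : Finset.univ.filter (RDAdjP faceRank v Q) = {a, b} := by
    ext u; simp [h]
  have ha := (h a).2 (.inl rfl)
  have hb := (h b).2 (.inr rfl)
  have ha' : rdPt a ≠ rdPt v := fun e => ha.2.1 (rdPt_inj ha.1 hv e)
  have hb' : rdPt b ≠ rdPt v := fun e => hb.2.1 (rdPt_inj hb.1 hv e)
  rw [rdTheta, e, Finset.sum_pair hab, Finset.sum_pair hab, Finset.sum_pair hab,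
    EuclideanGeometry.angle_self_of_ne ha', EuclideanGeometry.angle_self_of_ne hb',
    EuclideanGeometry.angle_comm (rdPt b)]
  ring

theorem rd_claim_vertex [Fintype (Faces P)] {F v : Faces P} (hF : faceRank F = 3)
    (hv : faceRank v = 0) (Q w : Fin 4 → Faces P)
    (h : ∀ i, faceRank (Q i) = 2 ∧ faceRank (w i) = 0 ∧ v < Q i ∧ Q i < F ∧ w i < Q i ∧
      w (i + 1) < Q i ∧ ¬ w (i + 2) < Q i ∧ ¬ w (i + 3) < Q i)
    (hadj : ∀ i u, RDAdjP faceRank v (Q i) u ↔ u = w i ∨ u = w (i + 1)) :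
    ∑ i, rdTheta v (Q i) < 4 * Real.pi := by
  obtain ⟨c, hc, i0, hi0⟩ := rd_dependent (k := 4) (W := (affineSpan ℝ F.1).direction)
    (by rw [rd_finrank (k := 3) hF]; norm_num) (fun i => rdPt (w i) - rdPt v)
    (fun i => rd_sub_mem (rdPt_mem (h i).2.1 ((h i).2.2.2.2.1.trans (h i).2.2.2.1))
      (rdPt_mem hv ((h i).2.2.1.trans (h i).2.2.2.1)))
  have hl : ∀ i, ∃ l : EucSp n →ₗ[ℝ] ℝ, l (rdPt (w i) - rdPt v) = 0 ∧
      l (rdPt (w (i + 1)) - rdPt v) = 0 ∧ l (rdPt (w (i + 2)) - rdPt v) < 0 ∧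
      l (rdPt (w (i + 3)) - rdPt v) < 0 := by
    intro i
    obtain ⟨h1, h2, h3, h4, h5, h6, h7, h8⟩ := h i
    obtain ⟨l, m, hlm⟩ := rd_func (Q i) (by omega)
    have a0 := (hlm v hv).1 h3
    have a1 := (hlm _ h2).1 h5
    have a2 := (hlm _ (h (i + 1)).2.1).1 h6
    have a3 := (hlm _ (h (i + 2)).2.1).2 h7
    have a4 := (hlm _ (h (i + 3)).2.1).2 h8
    refine ⟨l, ?_, ?_, ?_, ?_⟩ <;> rw [map_sub] <;> linarith
  obtain ⟨l0, l00, l01, l02, l03⟩ := hl 0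
  obtain ⟨l2, l22, l23, l20, l21⟩ := hl 2
  obtain ⟨l3, l33, l30, l31, l32⟩ := hl 3
  change l0 (rdPt (w 1) - rdPt v) = 0 at l01
  change l0 (rdPt (w 2) - rdPt v) < 0 at l02
  change l0 (rdPt (w 3) - rdPt v) < 0 at l03
  change l2 (rdPt (w 3) - rdPt v) = 0 at l23
  change l2 (rdPt (w 0) - rdPt v) < 0 at l20
  change l2 (rdPt (w 1) - rdPt v) < 0 at l21
  change l3 (rdPt (w 0) - rdPt v) = 0 at l30
  change l3 (rdPt (w 1) - rdPt v) < 0 at l31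
  change l3 (rdPt (w 2) - rdPt v) < 0 at l32
  have hne : ∀ i, w i ≠ w (i + 1) := by
    intro i e
    have h1 := (h (i + 3)).2.2.2.2.2.1
    have h2 := (h (i + 3)).2.2.2.2.2.2.1
    have e1 : i + 3 + 1 = i := by fin_cases i <;> rfl
    have e2 : i + 3 + 2 = i + 1 := by fin_cases i <;> rfl
    rw [e1] at h1
    rw [e2, ← e] at h2
    exact h2 h1
  have hsum : ∑ i, rdTheta v (Q i) = 2 * (InnerProductGeometry.angle (rdPt (w 0) - rdPt v)
      (rdPt (w 1) - rdPt v) + InnerProductGeometry.angle (rdPt (w 1) - rdPt v)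
      (rdPt (w 2) - rdPt v) + InnerProductGeometry.angle (rdPt (w 2) - rdPt v)
      (rdPt (w 3) - rdPt v) + InnerProductGeometry.angle (rdPt (w 3) - rdPt v)
      (rdPt (w 0) - rdPt v)) := by
    rw [Fin.sum_univ_four, rdTheta_eq hv (hne 0) (hadj 0), rdTheta_eq hv (hne 1) (hadj 1),
      rdTheta_eq hv (hne 2) (hadj 2), rdTheta_eq hv (hne 3) (hadj 3), mul_add, mul_add, mul_add]
    rfl
  rw [hsum]
  rw [Fin.sum_univ_four] at hc
  generalize rdPt (w 0) - rdPt v = u0 at *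
  generalize rdPt (w 1) - rdPt v = u1 at *
  generalize rdPt (w 2) - rdPt v = u2 at *
  generalize rdPt (w 3) - rdPt v = u3 at *
  have hl' : ∀ l : EucSp n →ₗ[ℝ] ℝ, c 0 * l u0 + c 1 * l u1 + c 2 * l u2 + c 3 * l u3 = 0 := by
    intro l
    have := congrArg l hc
    simpa only [map_add, map_smul, smul_eq_mul, map_zero] using this
  have hc0 : ¬ (c 0 = 0 ∧ c 1 = 0 ∧ c 2 = 0 ∧ c 3 = 0) := by
    rintro ⟨k0, k1, k2, k3⟩
    apply hi0
    match i0 with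
    | 0 => exact k0
    | 1 => exact k1
    | 2 => exact k2
    | 3 => exact k3
  have e0 := hl' l0
  have e2 := hl' l2
  have e3 := hl' l3
  rw [l00, l01] at e0
  rw [l22, l23] at e2
  rw [l33, l30] at e3
  rcases rd_signs hc0 l02 l03 l20 l21 l31 l32 (by linarith) (by linarith) (by linarith) with
    ⟨s0, s1, s2, s3⟩ | ⟨s0, s1, s2, s3⟩
  · have := rd_pyramid s0 s1 s2 s3 (by
      rw [neg_smul, neg_smul, ← sub_eq_zero, ← hc]; abel) l0 l2 l3 l00 l01 l02 l22 l23 l21 l30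
      l31 l32
    linarith
  · have := rd_pyramid s0 s1 s2 s3 (by
      rw [neg_smul, neg_smul, eq_comm, ← sub_eq_zero, ← hc]; abel) l0 l2 l3 l00 l01 l02 l22 l23
      l21 l30 l31 l32
    linarith

theorem rd_claim_quad [Fintype (Faces P)] {Q : Faces P} (hQ : faceRank Q = 2)
    (x E : Fin 4 → Faces P)
    (h : ∀ i, faceRank (x i) = 0 ∧ faceRank (E i) = 1 ∧ x i < Q ∧ x i < E i ∧ x (i + 1) < E i ∧
        ¬ x (i + 2) < E i ∧ ¬ x (i + 3) < E i)
    (hadj : ∀ i u, RDAdjP faceRank (x i) Q u ↔ u = x (i + 3) ∨ u = x (i + 1))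
    (hinj : Function.Injective x) :
    ∑ i, rdTheta (x i) Q = 4 * Real.pi := by
  obtain ⟨b, hb, i0, hi0⟩ := rd_dependent (k := 3) (W := (affineSpan ℝ Q.1).direction)
    (by rw [rd_finrank (k := 2) hQ]; norm_num) (fun i => rdPt (x i.succ) - rdPt (x 0))
    (fun i => rd_sub_mem (rdPt_mem (h _).1 (h _).2.2.1) (rdPt_mem (h _).1 (h _).2.2.1))
  have hl : ∀ i, ∃ (l : EucSp n →ₗ[ℝ] ℝ) (m : ℝ), l (rdPt (x i)) = m ∧
      l (rdPt (x (i + 1))) = m ∧ l (rdPt (x (i + 2))) - m < 0 ∧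
      l (rdPt (x (i + 3))) - m < 0 := by
    intro i
    obtain ⟨h1, h2, h3, h4, h5, h6, h7⟩ := h i
    obtain ⟨l, m, hlm⟩ := rd_func (E i) (by omega)
    have a1 := (hlm _ h1).1 h4
    have a2 := (hlm _ (h (i + 1)).1).1 h5
    have a3 := (hlm _ (h (i + 2)).1).2 h6
    have a4 := (hlm _ (h (i + 3)).1).2 h7
    exact ⟨l, m, a1, a2, by linarith, by linarith⟩
  obtain ⟨l0, m0, l00, l01, l02, l03⟩ := hl 0
  obtain ⟨l2, m2, l22, l23, l20, l21⟩ := hl 2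
  obtain ⟨l3, m3, l33, l30, l31, l32⟩ := hl 3
  change l0 (rdPt (x 1)) = m0 at l01
  change l0 (rdPt (x 2)) - m0 < 0 at l02
  change l0 (rdPt (x 3)) - m0 < 0 at l03
  change l2 (rdPt (x 3)) = m2 at l23
  change l2 (rdPt (x 0)) - m2 < 0 at l20
  change l2 (rdPt (x 1)) - m2 < 0 at l21
  change l3 (rdPt (x 0)) = m3 at l30
  change l3 (rdPt (x 1)) - m3 < 0 at l31
  change l3 (rdPt (x 2)) - m3 < 0 at l32
  have hne : ∀ i, x (i + 3) ≠ x (i + 1) := by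
    intro i e
    have := hinj e
    revert this
    fin_cases i <;> decide
  have hsum : ∑ i, rdTheta (x i) Q = 2 * (
      EuclideanGeometry.angle (rdPt (x 3)) (rdPt (x 0)) (rdPt (x 1)) +
      EuclideanGeometry.angle (rdPt (x 0)) (rdPt (x 1)) (rdPt (x 2)) +
      EuclideanGeometry.angle (rdPt (x 1)) (rdPt (x 2)) (rdPt (x 3)) +
      EuclideanGeometry.angle (rdPt (x 2)) (rdPt (x 3)) (rdPt (x 0))) := by
    rw [Fin.sum_univ_four, rdTheta_eq (h 0).1 (hne 0) (hadj 0),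
      rdTheta_eq (h 1).1 (hne 1) (hadj 1), rdTheta_eq (h 2).1 (hne 2) (hadj 2),
      rdTheta_eq (h 3).1 (hne 3) (hadj 3), mul_add, mul_add, mul_add]
    rfl
  have n02 : rdPt (x 0) ≠ rdPt (x 2) := by
    intro e
    have := hinj (rdPt_inj (h 0).1 (h 2).1 e)
    revert this
    decide
  have n13 : rdPt (x 1) ≠ rdPt (x 3) := by
    intro e
    have := hinj (rdPt_inj (h 1).1 (h 3).1 e)
    revert this
    decide
  rw [hsum]
  rw [Fin.sum_univ_three] at hb
  change b 0 • (rdPt (x 1) - rdPt (x 0)) + b 1 • (rdPt (x 2) - rdPt (x 0)) +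
    b 2 • (rdPt (x 3) - rdPt (x 0)) = 0 at hb
  clear hsum hl
  generalize rdPt (x 0) = u0 at *
  generalize rdPt (x 1) = u1 at *
  generalize rdPt (x 2) = u2 at *
  generalize rdPt (x 3) = u3 at *
  obtain ⟨a, ha⟩ : ∃ a, a = -(b 0 + b 1 + b 2) := ⟨_, rfl⟩
  have hc : a • u0 + b 0 • u1 + b 1 • u2 + b 2 • u3 = 0 := by
    rw [← hb, ha]; module
  have hl' : ∀ (l : EucSp n →ₗ[ℝ] ℝ) (m : ℝ), a * (l u0 - m) + b 0 * (l u1 - m) +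
      b 1 * (l u2 - m) + b 2 * (l u3 - m) = 0 := by
    intro l m
    have := congrArg l hc
    simp only [map_add, map_smul, smul_eq_mul, map_zero] at this
    have e : a * m + b 0 * m + b 1 * m + b 2 * m = 0 := by rw [ha]; ring
    linarith
  have hc0 : ¬ (a = 0 ∧ b 0 = 0 ∧ b 1 = 0 ∧ b 2 = 0) := by
    rintro ⟨-, k1, k2, k3⟩
    apply hi0
    match i0 with
    | 0 => exact k1
    | 1 => exact k2
    | 2 => exact k3
  have e0 := hl' l0 m0
  have e2 := hl' l2 m2
  have e3 := hl' l3 m3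
  rw [l00, l01, sub_self] at e0
  rw [l22, l23, sub_self] at e2
  rw [l33, l30, sub_self] at e3
  rcases rd_signs hc0 l02 l03 l20 l21 l31 l32 (by linarith) (by linarith) (by linarith) with
    ⟨s0, s1, s2, s3⟩ | ⟨s0, s1, s2, s3⟩
  · have := rd_quad s0 s1 s2 s3 (by
      rw [neg_smul, neg_smul, ← sub_eq_zero, ← hc]; abel) (by linarith) n02 n13
    linarith
  · have := rd_quad s0 s1 s2 s3 (by
      rw [neg_smul, neg_smul, eq_comm, ← sub_eq_zero, ← hc]; abel) (by linarith) n02 n13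
    linarith

theorem rd_final (S : Finset (EucSp 4)) (hne : S.Nonempty)
    (hF : ∀ F : Faces (convexHull ℝ (S : Set (EucSp 4))), faceRank F = 3 →
      Nonempty ({G : Faces (convexHull ℝ (S : Set (EucSp 4))) // G ≤ F} ≃o
        Faces RhombicDodecahedron))
    (hV : ∀ v : Faces (convexHull ℝ (S : Set (EucSp 4))), faceRank v = 0 →
      Nonempty ({G : Faces (convexHull ℝ (S : Set (EucSp 4))) // v ≤ G} ≃o
        Faces Cuboctahedron)) : False := by
  have := rd_finite_faces S
  obtain ⟨_⟩ := nonempty_fintype (Faces (convexHull ℝ (S : Set (EucSp 4))))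
  have up : ∀ v : Faces (convexHull ℝ (S : Set (EucSp 4))), faceRank v = 0 →
      ∃ d, RDUp faceRank v d := by
    intro v hv
    obtain ⟨e⟩ := hV v hv
    obtain ⟨e'⟩ := rd_cubocta_iso
    exact rd_exists_up rd_rank_strictMono (fun x => rd_rank_le x) v hv (e'.trans e.symm)
  have down : ∀ F : Faces (convexHull ℝ (S : Set (EucSp 4))), faceRank F = 3 →
      ∃ d, RDDown faceRank F d := by
    intro v hv
    obtain ⟨e⟩ := hF v hv
    obtain ⟨e'⟩ := rd_rhombic_iso
    exact rd_exists_down rd_rank_strictMono (fun x => rd_rank_ge x) v hv (e'.trans e.symm)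
  obtain ⟨v0, hv0⟩ := rd_exists_vertex S hne
  obtain ⟨d0, hd0⟩ := up v0 hv0
  obtain ⟨F0, hF0⟩ := hd0.exists_facet
  have quads : ∀ Q ∈ (Finset.univ.filter (fun Q : Faces (convexHull ℝ (S : Set (EucSp 4))) =>
      faceRank Q = 2 ∧ ∃ F, faceRank F = 3 ∧ Q < F)), faceRank Q = 2 ∧ ∃ x E : Fin 4 → Faces _,
      (∀ i, faceRank (x i) = 0 ∧ faceRank (E i) = 1 ∧ x i < Q ∧ x i < E i ∧ x (i + 1) < E i ∧
        ¬ x (i + 2) < E i ∧ ¬ x (i + 3) < E i) ∧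
      Function.Injective x ∧ (∀ u, faceRank u = 0 → u < Q → ∃ i, u = x i) ∧
      (∀ i u, RDAdjP faceRank (x i) Q u ↔ u = x (i + 3) ∨ u = x (i + 1)) := by
    intro Q hQ
    simp only [Finset.mem_filter, Finset.mem_univ, true_and] at hQ
    obtain ⟨h2, F, hF3, hQF⟩ := hQ
    obtain ⟨d, hd⟩ := down F hF3
    exact ⟨h2, hd.quad h2 hQF⟩
  refine rd_count (Finset.univ.filter (fun v : Faces (convexHull ℝ (S : Set (EucSp 4))) =>
      faceRank v = 0))
    (Finset.univ.filter (fun Q => faceRank Q = 2 ∧ ∃ F, faceRank F = 3 ∧ Q < F))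
    (Finset.univ.filter (fun F => faceRank F = 3)) (RDT4 faceRank) rdTheta ⟨F0, by simp [hF0]⟩
    ?_ ?_ ?_ ?_ ?_ ?_
  · intro f hf
    simp only [Finset.mem_filter, Finset.mem_univ, true_and] at hf
    obtain ⟨d, hd⟩ := down f hf
    rw [← hd.twelve hf, Finset.filter_filter]
    congr 1
    refine Finset.filter_congr fun q _ => ?_
    exact ⟨fun h => ⟨h.1.1, h.2⟩, fun h => ⟨⟨h.1, f, hf, h.2⟩, h.2⟩⟩
  · intro q hq
    obtain ⟨hq2, x, E, h1, -⟩ := quads q hq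
    obtain ⟨d, hd⟩ := up (x 0) (h1 0).1
    rw [← hd.two (h1 0).2.2.1 hq2, Finset.filter_filter]
  · intro f hf
    simp only [Finset.mem_filter, Finset.mem_univ, true_and] at hf
    obtain ⟨d, hd⟩ := down f hf
    rw [← hd.six hf, Finset.filter_filter]
  · intro q hq v hv hvq
    simp only [Finset.mem_filter, Finset.mem_univ, true_and] at hq hv
    obtain ⟨d, hd⟩ := up v hv
    rw [← hd.one hv hvq hq.1, Finset.filter_filter]
  · intro f hf v hv hvf ht
    simp only [Finset.mem_filter, Finset.mem_univ, true_and] at hf hv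
    obtain ⟨d, hd⟩ := down f hf
    obtain ⟨Q, w, h1, h2, h3, h4⟩ := hd.around hf hv hvf ht
    have e : (Finset.univ.filter (fun Q => faceRank Q = 2 ∧ ∃ F, faceRank F = 3 ∧ Q < F)).filter
        (fun q => v < q ∧ q < f) = Finset.univ.image Q := by
      ext q
      simp only [Finset.mem_filter, Finset.mem_univ, true_and, Finset.mem_image]
      constructor
      · rintro ⟨⟨a, -⟩, b, c⟩
        obtain ⟨i, hi⟩ := h3 q a b c
        exact ⟨i, hi.symm⟩
      · rintro ⟨i, rfl⟩
        obtain ⟨a1, a2, a3, a4, -⟩ := h1 i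
        exact ⟨⟨a1, f, hf, a4⟩, a3, a4⟩
    rw [e, Finset.sum_image (fun i _ j _ hij => h2 hij)]
    exact rd_claim_vertex hf hv Q w h1 h4
  · intro q hq
    obtain ⟨hq2, x, E, h1, h2, h3, h4⟩ := quads q hq
    have e : (Finset.univ.filter (fun v : Faces (convexHull ℝ (S : Set (EucSp 4))) =>
        faceRank v = 0)).filter (fun v => v < q) = Finset.univ.image x := by
      ext u
      simp only [Finset.mem_filter, Finset.mem_univ, true_and, Finset.mem_image]
      constructor
      · rintro ⟨a, b⟩
        obtain ⟨i, hi⟩ := h3 u a b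
        exact ⟨i, hi.symm⟩
      · rintro ⟨i, rfl⟩
        exact ⟨(h1 i).1, (h1 i).2.2.1⟩
    rw [e, Finset.sum_image (fun i _ j _ hij => h2 hij)]
    exact rd_claim_quad hq2 x E h1 h4 h2

end RDFinal

/-- There is no convex 4-polytope all of whose facets are (combinatorially)
rhombic dodecahedra and all of whose vertex figures are (combinatorially) cuboctahedra. -/
theorem no_rhombic_dodecahedral_four_polytope :
    ¬ ∃ P : Set (EucSp 4), IsConvexPolytope P ∧
      (∀ F : Faces P, faceRank F = 3 →
        Nonempty ({G : Faces P // G ≤ F} ≃o Faces RhombicDodecahedron)) ∧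
      (∀ v : Faces P, faceRank v = 0 →
        Nonempty ({G : Faces P // v ≤ G} ≃o Faces Cuboctahedron)) := by
  rintro ⟨P, ⟨⟨S, rfl⟩, hInt⟩, hF, hV⟩
  refine rd_final S ?_ hF hV
  rw [Finset.nonempty_iff_ne_empty]
  rintro rfl
  simp at hInt
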